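/- arXiv:2202.03802 — 3 statements merged into one kernel-verified Lean document; each statement's English description precedes it below -/
import Mathlib

section
/- Let (π, T) be a faithful representation of L on a Hilbert space H, i.e. π is injective. If a ∈ C₀(X) is such that π(a) belongs to the closed linear span of {π(b) T T* π(c) : b, c ∈ C₀(Δ)}, then a vanishes at every point of X ∖ Δ_reg; that is, a ∈ C₀(Δ_reg). -/
open scoped ZeroAtInfty

noncomputable section

variable {X : Type*} [TopologicalSpace X]

/-- The fibre of `φ : Δ → X` over `y`. -/
def Fiber (Δ : Set X) (φ : X → X) (y : X) : Set X := {x | x ∈ Δ ∧ φ x = y}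

/-- `ρ : Δ → [0,∞)` is a potential with bound `M`: it is nonnegative on `Δ`, the sums
`Σ_{x ∈ φ⁻¹(y)} ρ(x)` are (summable and) bounded by `M`, and for every `a ∈ C₀(Δ)` the
function `L(a)(y) = Σ_{x ∈ φ⁻¹(y)} ρ(x) a(x)` belongs to `C₀(X)`. -/
def IsPotential (Δ : Set X) (φ : X → X) (ρ : X → ℝ) (M : ℝ) : Prop :=
  (∀ x ∈ Δ, 0 ≤ ρ x) ∧
  (∀ y : X, Summable fun x : Fiber Δ φ y => ρ x.1) ∧
  (∀ y : X, (∑' x : Fiber Δ φ y, ρ x.1) ≤ M) ∧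
  ∀ a : C₀(X, ℂ), (∀ x ∉ Δ, a x = 0) →
    ∃ b : C₀(X, ℂ), ∀ y : X, b y = ∑' x : Fiber Δ φ y, (ρ x.1 : ℂ) * a x.1

/-- `Δ_pos`: the set of points of `Δ` where `ρ` is strictly positive. -/
def Dpos (Δ : Set X) (ρ : X → ℝ) : Set X := {x | x ∈ Δ ∧ 0 < ρ x}

/-- `Δ_reg`: the set of points of `Δ_pos` where `ρ` (as a function on `Δ`) is continuous. -/
def Dreg (Δ : Set X) (ρ : X → ℝ) : Set X :=
  {x | x ∈ Δ ∧ 0 < ρ x ∧ ContinuousWithinAt ρ Δ x}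

/-- A representation `(π, T)` of the transfer operator `L` determined by `(Δ, φ, ρ)`:
`π` is a nondegenerate *-representation of `C₀(X)` and `T` satisfies
`π(L(a)) = T* π(a) T` for all `a ∈ C₀(Δ)`. -/
def IsRep (Δ : Set X) (φ : X → X) (ρ : X → ℝ) {H : Type*} [NormedAddCommGroup H]
    [InnerProductSpace ℂ H] [CompleteSpace H]
    (π : C₀(X, ℂ) →⋆ₙₐ[ℂ] (H →L[ℂ] H)) (T : H →L[ℂ] H) : Prop :=
  Dense (↑(Submodule.span ℂ {v : H | ∃ (a : C₀(X, ℂ)) (h : H), π a h = v}) : Set H) ∧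
  ∀ a b : C₀(X, ℂ), (∀ x ∉ Δ, a x = 0) →
    (∀ y : X, b y = ∑' x : Fiber Δ φ y, (ρ x.1 : ℂ) * a x.1) →
    π b = star T * π a * T


section helpers
open Filter Topology

lemma kat_bump {X : Type*} [TopologicalSpace X] [LocallyCompactSpace X] [T2Space X]
    (U : Set X) (hU : IsOpen U) (x : X) (hx : x ∈ U) :
    ∃ f : C₀(X, ℂ), f x = 1 ∧ (∀ z ∉ U, f z = 0) ∧ (∀ z, ∃ r : ℝ, 0 ≤ r ∧ r ≤ 1 ∧ f z = r) := by
  obtain ⟨f, h1, h0, hc, hI⟩ := exists_continuous_one_zero_of_isCompact (isCompact_singleton (x := x))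
    hU.isClosed_compl (by simpa using hx)
  refine ⟨⟨⟨fun z => (f z : ℂ), by fun_prop⟩, ?_⟩, ?_, ?_, ?_⟩
  · have : HasCompactSupport (fun z => (f z : ℂ)) := hc.comp_left (g := fun r : ℝ => (r : ℂ)) (by simp)
    exact this.is_zero_at_infty
  · have := h1 (Set.mem_singleton x)
    show ((f x : ℝ) : ℂ) = 1
    rw [this]; simp
  · intro z hz
    have := h0 (show z ∈ Uᶜ from hz)
    show ((f z : ℝ) : ℂ) = 0
    rw [this]; simp
  · intro z
    exact ⟨f z, (hI z).1, (hI z).2, rfl⟩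

lemma kat_norm_le {X : Type*} [TopologicalSpace X] (f : C₀(X, ℂ)) (C : ℝ) (hC : 0 ≤ C)
    (h : ∀ z, ‖f z‖ ≤ C) : ‖f‖ ≤ C := by
  rw [← ZeroAtInftyContinuousMap.norm_toBCF_eq_norm]
  exact (BoundedContinuousFunction.norm_le hC).2 h

lemma kat_le_norm {X : Type*} [TopologicalSpace X] (f : C₀(X, ℂ)) (z : X) : ‖f z‖ ≤ ‖f‖ := by
  rw [← ZeroAtInftyContinuousMap.norm_toBCF_eq_norm]
  exact BoundedContinuousFunction.norm_coe_le_norm f.toBCF z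

lemma kat_star {X : Type*} [TopologicalSpace X] (f : C₀(X, ℂ))
    (h : ∀ z, ∃ r : ℝ, 0 ≤ r ∧ r ≤ 1 ∧ f z = r) : star f = f := by
  ext z
  obtain ⟨r, -, -, hr⟩ := h z
  simp [hr]

lemma kat_abs {X : Type*} [TopologicalSpace X] (f : C₀(X, ℂ))
    (h : ∀ z, ∃ r : ℝ, 0 ≤ r ∧ r ≤ 1 ∧ f z = r) (z : X) : ‖f z‖ ≤ 1 := by
  obtain ⟨r, h0, h1, hr⟩ := h z
  rw [hr, Complex.norm_real, Real.norm_of_nonneg h0]; exact h1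

lemma kat_iso {X : Type*} [TopologicalSpace X] [LocallyCompactSpace X] [T2Space X]
    {H : Type*} [NormedAddCommGroup H] [InnerProductSpace ℂ H] [CompleteSpace H]
    (π : C₀(X, ℂ) →⋆ₙₐ[ℂ] (H →L[ℂ] H)) (hfaith : Function.Injective ⇑π) (u : C₀(X, ℂ)) :
    ‖π u‖ = ‖u‖ :=
  NonUnitalStarAlgHom.norm_map π hfaith u

lemma kat_local {X : Type*} [TopologicalSpace X] [LocallyCompactSpace X] [T2Space X]
    {H : Type*} [NormedAddCommGroup H] [InnerProductSpace ℂ H] [CompleteSpace H]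
    (π : C₀(X, ℂ) →⋆ₙₐ[ℂ] (H →L[ℂ] H)) (hfaith : Function.Injective ⇑π)
    (S A : H →L[ℂ] H) (u v : C₀(X, ℂ)) (hu : π u = star S * A * S) (hv : π v = star S * S)
    (ε : ℝ) (hε : 0 ≤ ε) (hA : ‖A‖ ≤ ε) (y : X) : ‖u y‖ ≤ ε * ‖v y‖ := by
  have key : ∀ δ > 0, ‖u y‖ ≤ ε * (‖v y‖ + δ) := by
    intro δ hδ
    have hop : IsOpen {z | ‖v z‖ < ‖v y‖ + δ} := isOpen_lt (by fun_prop) continuous_const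
    obtain ⟨d, d1, d0, dr⟩ := kat_bump _ hop y (by simp [hδ])
    have hds := kat_star d dr
    have e1 : π (d * u * d) = star (S * π d) * A * (S * π d) := by
      rw [map_mul, map_mul, hu, star_mul, ← map_star, hds]; simp only [mul_assoc]
    have e2 : π (d * v * d) = star (S * π d) * (S * π d) := by
      rw [map_mul, map_mul, hv, star_mul, ← map_star, hds]; simp only [mul_assoc]
    have n1 : ‖u y‖ ≤ ‖d * u * d‖ := by
      have := kat_le_norm (d * u * d) y
      simpa [d1] using this
    have n2 : ‖d * v * d‖ ≤ ‖v y‖ + δ := by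
      apply kat_norm_le _ _ (by positivity)
      intro z
      by_cases hz : ‖v z‖ < ‖v y‖ + δ
      · have h1 := kat_abs d dr z
        simp only [ZeroAtInftyContinuousMap.mul_apply, norm_mul]
        have : ‖d z‖ * ‖v z‖ * ‖d z‖ ≤ 1 * ‖v z‖ * 1 := by gcongr
        linarith
      · simp [d0 z hz]; positivity
    have n3 : ‖d * v * d‖ = ‖S * π d‖ * ‖S * π d‖ := by
      rw [← kat_iso π hfaith, e2, CStarRing.norm_star_mul_self]
    have n4 : ‖d * u * d‖ ≤ ‖S * π d‖ * ε * ‖S * π d‖ := by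
      rw [← kat_iso π hfaith, e1]
      calc _ ≤ ‖star (S * π d)‖ * ‖A‖ * ‖S * π d‖ := 
            (norm_mul_le _ _).trans (by gcongr; exact norm_mul_le _ _)
        _ ≤ _ := by rw [norm_star]; gcongr
    calc ‖u y‖ ≤ ‖S * π d‖ * ε * ‖S * π d‖ := n1.trans n4
      _ = ε * ‖d * v * d‖ := by rw [n3]; ring
      _ ≤ _ := by gcongr
  have : Tendsto (fun δ : ℝ => ε * (‖v y‖ + δ)) (𝓝[>] 0) (𝓝 (ε * (‖v y‖ + 0))) := by
    apply Tendsto.mono_left _ nhdsWithin_le_nhds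
    exact Continuous.tendsto (by fun_prop) 0
  rw [add_zero] at this
  exact ge_of_tendsto this (eventually_mem_nhdsWithin.mono fun δ hδ => key δ hδ)

/-- nets of bump functions concentrating at a point of a fibre -/
def KatNet {X : Type*} [TopologicalSpace X] (Δ : Set X) (φ : X → X) (x : X)
    (f : Finset (Fiber Δ φ (φ x)) → C₀(X, ℂ)) : Prop :=
  (∀ F, f F x = 1) ∧ (∀ F, ∀ z ∉ Δ, f F z = 0) ∧
  (∀ F z, ∃ r : ℝ, 0 ≤ r ∧ r ≤ 1 ∧ f F z = r) ∧
  ∀ z : Fiber Δ φ (φ x), z.1 ≠ x → ∀ᶠ F in atTop, f F z.1 = 0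

lemma kat_net {X : Type*} [TopologicalSpace X] [LocallyCompactSpace X] [T2Space X]
    (Δ : Set X) (φ : X → X) (hΔ : IsOpen Δ) (x : X) (hx : x ∈ Δ) : ∃ f, KatNet Δ φ x f := by
  classical
  have : ∀ F : Finset (Fiber Δ φ (φ x)), ∃ f : C₀(X, ℂ), f x = 1 ∧
      (∀ z ∉ Δ \ ((F.image Subtype.val).erase x : Finset X), f z = 0) ∧
      (∀ z, ∃ r : ℝ, 0 ≤ r ∧ r ≤ 1 ∧ f z = r) := by
    intro F
    apply kat_bump
    · exact hΔ.sdiff (Finset.finite_toSet _).isClosed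
    · simp [hx]
  choose f h1 h0 hr using this
  refine ⟨f, h1, fun F z hz => h0 F z (fun h => hz h.1), hr, ?_⟩
  intro z hz
  filter_upwards [eventually_ge_atTop {z}] with F hF
  apply h0
  rintro ⟨-, h⟩
  apply h
  have : z ∈ F := hF (by simp)
  simp only [Finset.coe_erase, Set.mem_sdiff, Finset.mem_coe, Finset.mem_image, Set.mem_singleton_iff]
  exact ⟨⟨z, this, rfl⟩, hz⟩

lemma kat_conv {X : Type*} [TopologicalSpace X] [LocallyCompactSpace X] [T2Space X]
    (Δ : Set X) (φ : X → X) (ρ : X → ℝ) (M : ℝ) (hpot : IsPotential Δ φ ρ M)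
    (x : X) (hx : x ∈ Δ) (f : Finset (Fiber Δ φ (φ x)) → C₀(X, ℂ)) (hf : KatNet Δ φ x f)
    (h : Finset (Fiber Δ φ (φ x)) → C₀(X, ℂ)) (C : ℝ) (hC : ∀ F z, ‖h F z‖ ≤ C) (c : ℂ)
    (hc : ∀ F, h F x = c) :
    Tendsto (fun F => ∑' z : Fiber Δ φ (φ x), (ρ z.1 : ℂ) * (f F * h F) z.1) atTop
      (𝓝 (ρ x * c)) := by
  classical
  let x' : Fiber Δ φ (φ x) := ⟨x, hx, rfl⟩
  have e : (ρ x * c : ℂ) = ∑' z : Fiber Δ φ (φ x), if z = x' then (ρ x * c : ℂ) else 0 := by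
    rw [tsum_ite_eq]
  rw [e]
  apply tendsto_tsum_of_dominated_convergence (bound := fun z => ρ z.1 * C)
  · exact (hpot.2.1 _).mul_right _
  · intro z
    split_ifs with hz
    · subst hz
      apply tendsto_const_nhds.congr
      intro F
      simp [x', hf.1, hc]
    · apply tendsto_const_nhds.congr'
      filter_upwards [hf.2.2.2 z (fun h => hz (Subtype.ext h))] with F hF
      simp [hF]
  · refine Eventually.of_forall fun F z => ?_
    have h0 := hpot.1 z.1 z.2.1
    have h1 := kat_abs (f F) (hf.2.2.1 F) z.1
    have h2 := hC F z.1
    simp only [ZeroAtInftyContinuousMap.mul_apply, norm_mul, Complex.norm_real, Real.norm_of_nonneg h0]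
    gcongr
    calc _ ≤ 1 * C := by gcongr
      _ = C := one_mul C


/-- the span of generalized compact operators -/
abbrev katSpan {X : Type*} [TopologicalSpace X] (Δ : Set X)
    {H : Type*} [NormedAddCommGroup H] [InnerProductSpace ℂ H] [CompleteSpace H]
    (π : C₀(X, ℂ) →⋆ₙₐ[ℂ] (H →L[ℂ] H)) (T : H →L[ℂ] H) : Submodule ℂ (H →L[ℂ] H) :=
  Submodule.span ℂ {x : H →L[ℂ] H | ∃ b c : C₀(X, ℂ),
      (∀ z ∉ Δ, b z = 0) ∧ (∀ z ∉ Δ, c z = 0) ∧ x = π b * T * star T * π c}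

lemma kat_span {X : Type*} [TopologicalSpace X] [LocallyCompactSpace X] [T2Space X]
    (Δ : Set X) (φ : X → X) (ρ : X → ℝ) (M : ℝ) (hpot : IsPotential Δ φ ρ M)
    {H : Type*} [NormedAddCommGroup H] [InnerProductSpace ℂ H] [CompleteSpace H]
    (π : C₀(X, ℂ) →⋆ₙₐ[ℂ] (H →L[ℂ] H)) (T : H →L[ℂ] H) (hrep : IsRep Δ φ ρ π T)
    (k : H →L[ℂ] H) (hk : k ∈ katSpan Δ π T) :
    ∃ g : C₀(X, ℂ), (∀ z ∉ Δ, g z = 0) ∧ ∀ x ∈ Δ, ∀ f, KatNet Δ φ x f →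
      ∃ u : Finset (Fiber Δ φ (φ x)) → C₀(X, ℂ),
        (∀ F, π (u F) = star T * π (f F) * k * π (f F) * T) ∧
        Tendsto (fun F => u F (φ x)) atTop (𝓝 (ρ x * (ρ x * g x))) := by
  induction hk using Submodule.span_induction with
  | mem k hk =>
    obtain ⟨b, c, hb, hc, rfl⟩ := hk
    refine ⟨b * c, fun z hz => by simp [hb z hz], fun x hx f hf => ?_⟩
    have h1 : ∀ F, ∃ d : C₀(X, ℂ), π d = star T * π (f F * b) * T ∧
        d (φ x) = ∑' z : Fiber Δ φ (φ x), (ρ z.1 : ℂ) * (f F * b) z.1 := by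
      intro F
      have h0 : ∀ z ∉ Δ, (f F * b) z = 0 := fun z hz => by simp [hb z hz]
      obtain ⟨d, hd⟩ := hpot.2.2.2 (f F * b) h0
      exact ⟨d, hrep.2 _ _ h0 hd, hd _⟩
    have h2 : ∀ F, ∃ d : C₀(X, ℂ), π d = star T * π (f F * c) * T ∧
        d (φ x) = ∑' z : Fiber Δ φ (φ x), (ρ z.1 : ℂ) * (f F * c) z.1 := by
      intro F
      have h0 : ∀ z ∉ Δ, (f F * c) z = 0 := fun z hz => by simp [hc z hz]
      obtain ⟨d, hd⟩ := hpot.2.2.2 (f F * c) h0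
      exact ⟨d, hrep.2 _ _ h0 hd, hd _⟩
    choose d1 d1a d1b using h1
    choose d2 d2a d2b using h2
    refine ⟨fun F => d1 F * d2 F, fun F => ?_, ?_⟩
    · rw [map_mul, d1a, d2a, mul_comm (f F) c, map_mul, map_mul]
      simp only [mul_assoc]
    · have t1 := kat_conv Δ φ ρ M hpot x hx f hf (fun _ => b) ‖b‖ (fun _ z => kat_le_norm b z) (b x)
        (fun _ => rfl)
      have t2 := kat_conv Δ φ ρ M hpot x hx f hf (fun _ => c) ‖c‖ (fun _ z => kat_le_norm c z) (c x)
        (fun _ => rfl)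
      have := t1.mul t2
      have e : (ρ x * (ρ x * (b * c) x) : ℂ) = ρ x * b x * (ρ x * c x) := by
        simp only [ZeroAtInftyContinuousMap.mul_apply]; ring
      rw [e]
      refine this.congr fun F => ?_
      rw [ZeroAtInftyContinuousMap.mul_apply, d1b, d2b]
  | zero =>
    refine ⟨0, by simp, fun x hx f hf => ⟨fun _ => 0, by simp, by simp⟩⟩
  | add k l _ _ hk hl =>
    obtain ⟨g, hg0, hg⟩ := hk
    obtain ⟨g', hg0', hg'⟩ := hl
    refine ⟨g + g', fun z hz => by simp [hg0 z hz, hg0' z hz], fun x hx f hf => ?_⟩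
    obtain ⟨u, hu, ht⟩ := hg x hx f hf
    obtain ⟨u', hu', ht'⟩ := hg' x hx f hf
    refine ⟨fun F => u F + u' F, fun F => ?_, ?_⟩
    · rw [map_add, hu, hu']; simp only [mul_add, add_mul]
    · have := ht.add ht'
      simp only [ZeroAtInftyContinuousMap.add_apply, mul_add]
      exact this
  | smul t k _ hk =>
    obtain ⟨g, hg0, hg⟩ := hk
    refine ⟨t • g, fun z hz => by simp [hg0 z hz], fun x hx f hf => ?_⟩
    obtain ⟨u, hu, ht⟩ := hg x hx f hf
    refine ⟨fun F => t • u F, fun F => ?_, ?_⟩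
    · rw [map_smul, hu]; simp only [mul_smul_comm, smul_mul_assoc]
    · have := ht.const_mul t
      have e : (ρ x * (ρ x * (t • g) x) : ℂ) = t * (ρ x * (ρ x * g x)) := by
        simp only [ZeroAtInftyContinuousMap.smul_apply, smul_eq_mul]; ring
      rw [e]
      exact this

lemma kat_approx {X : Type*} [TopologicalSpace X] [LocallyCompactSpace X] [T2Space X]
    (Δ : Set X) (φ : X → X) (ρ : X → ℝ) (M : ℝ) (hΔ : IsOpen Δ) (hpot : IsPotential Δ φ ρ M)
    {H : Type*} [NormedAddCommGroup H] [InnerProductSpace ℂ H] [CompleteSpace H]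
    (π : C₀(X, ℂ) →⋆ₙₐ[ℂ] (H →L[ℂ] H)) (T : H →L[ℂ] H) (hrep : IsRep Δ φ ρ π T)
    (hfaith : Function.Injective ⇑π) (a : C₀(X, ℂ))
    (ha : π a ∈ closure (katSpan Δ π T : Set (H →L[ℂ] H))) (ε : ℝ) (hε : 0 < ε) :
    ∃ g : C₀(X, ℂ), (∀ z ∉ Δ, g z = 0) ∧ ∀ x ∈ Δ, 0 < ρ x → ‖a x - ρ x * g x‖ ≤ ε := by
  obtain ⟨k, hk, hd⟩ := Metric.mem_closure_iff.1 ha ε hε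
  obtain ⟨g, hg0, hg⟩ := kat_span Δ φ ρ M hpot π T hrep k hk
  refine ⟨g, hg0, fun x hx hρ => ?_⟩
  obtain ⟨f, hf⟩ := kat_net Δ φ hΔ x hx
  obtain ⟨u, hu, ht⟩ := hg x hx f hf
  have h1 : ∀ F, ∃ d : C₀(X, ℂ), π d = star T * π (f F * (a * f F)) * T ∧
      d (φ x) = ∑' z : Fiber Δ φ (φ x), (ρ z.1 : ℂ) * (f F * (a * f F)) z.1 := by
    intro F
    have h0 : ∀ z ∉ Δ, (f F * (a * f F)) z = 0 := fun z hz => by simp [hf.2.1 F z hz]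
    obtain ⟨d, hd⟩ := hpot.2.2.2 _ h0
    exact ⟨d, hrep.2 _ _ h0 hd, hd _⟩
  have h2 : ∀ F, ∃ d : C₀(X, ℂ), π d = star T * π (f F * f F) * T ∧
      d (φ x) = ∑' z : Fiber Δ φ (φ x), (ρ z.1 : ℂ) * (f F * f F) z.1 := by
    intro F
    have h0 : ∀ z ∉ Δ, (f F * f F) z = 0 := fun z hz => by simp [hf.2.1 F z hz]
    obtain ⟨d, hd⟩ := hpot.2.2.2 _ h0
    exact ⟨d, hrep.2 _ _ h0 hd, hd _⟩
  choose d1 d1a d1b using h1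
  choose d2 d2a d2b using h2
  have t1 := kat_conv Δ φ ρ M hpot x hx f hf (fun F => a * f F) ‖a‖ (fun F z => by
    have h1 := kat_abs (f F) (hf.2.2.1 F) z
    have h2 := kat_le_norm a z
    simp only [ZeroAtInftyContinuousMap.mul_apply, norm_mul]
    calc _ ≤ ‖a‖ * 1 := by gcongr
      _ = _ := mul_one _) (a x) (fun F => by simp [hf.1])
  have t2 := kat_conv Δ φ ρ M hpot x hx f hf (fun F => f F) 1
    (fun F z => kat_abs (f F) (hf.2.2.1 F) z) 1 hf.1
  have main : ∀ F, ‖(d1 F - u F) (φ x)‖ ≤ ε * ‖d2 F (φ x)‖ := by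
    intro F
    have hs := kat_star (f F) (hf.2.2.1 F)
    apply kat_local π hfaith (π (f F) * T) (π a - k) _ _ _ _ ε hε.le
    · rw [← dist_eq_norm]; exact hd.le
    · rw [map_sub, d1a, hu, star_mul, ← map_star, hs, map_mul, map_mul]
      simp only [mul_assoc, mul_sub, sub_mul]
    · rw [d2a, star_mul, ← map_star, hs, map_mul]
      simp only [mul_assoc]
  have l1 : Tendsto (fun F => ‖(d1 F - u F) (φ x)‖) atTop
      (𝓝 ‖(ρ x * a x - ρ x * (ρ x * g x) : ℂ)‖) := by
    refine ((t1.sub ht).norm).congr fun F => ?_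
    rw [ZeroAtInftyContinuousMap.sub_apply, d1b]
  have l2 : Tendsto (fun F => ε * ‖d2 F (φ x)‖) atTop (𝓝 (ε * ‖(ρ x * 1 : ℂ)‖)) := by
    refine (t2.norm.const_mul ε).congr fun F => ?_
    rw [d2b]
  have := le_of_tendsto_of_tendsto' l1 l2 main
  rw [← mul_sub, norm_mul, mul_one, Complex.norm_real, Real.norm_of_nonneg hρ.le, mul_comm ε] at this
  exact le_of_mul_le_mul_left this hρ

lemma kat_zero_int {X : Type*} [TopologicalSpace X] [LocallyCompactSpace X] [T2Space X]
    (Δ : Set X) (φ : X → X) (ρ : X → ℝ)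
    {H : Type*} [NormedAddCommGroup H] [InnerProductSpace ℂ H] [CompleteSpace H]
    (π : C₀(X, ℂ) →⋆ₙₐ[ℂ] (H →L[ℂ] H)) (T : H →L[ℂ] H) (hrep : IsRep Δ φ ρ π T)
    (hfaith : Function.Injective ⇑π) (a : C₀(X, ℂ))
    (ha : π a ∈ closure (katSpan Δ π T : Set (H →L[ℂ] H)))
    (U : Set X) (hU : IsOpen U) (hUΔ : U ⊆ Δ) (h0 : ∀ z ∈ U, ρ z = 0) (x : X) (hx : x ∈ U) :
    a x = 0 := by
  obtain ⟨e, e1, e0, er⟩ := kat_bump U hU x hx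
  have hs := kat_star e er
  have hz : ∀ z, (ρ z : ℂ) * (e * e) z = 0 := by
    intro z
    by_cases hz : z ∈ U
    · simp [h0 z hz]
    · simp [e0 z hz]
  have h1 := hrep.2 (e * e) 0 (fun z hz => by simp [e0 z (fun h => hz (hUΔ h))])
    (fun y => by simp only [hz]; simp)
  have h2 : π e * T = 0 := by
    rw [← CStarRing.star_mul_self_eq_zero_iff, star_mul, ← map_star, hs]
    rw [map_zero, map_mul] at h1
    rw [h1]; simp only [mul_assoc]
  have h3 : ∀ k ∈ katSpan Δ π T, π e * k = 0 := by
    intro k hk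
    induction hk using Submodule.span_induction with
    | mem k hk =>
      obtain ⟨b, c, -, -, rfl⟩ := hk
      have : π e * (π b * T * star T * π c) = π b * (π e * T) * star T * π c := by
        rw [← mul_assoc, ← mul_assoc, ← mul_assoc, ← map_mul, mul_comm e b, map_mul]
        simp only [mul_assoc]
      rw [this, h2]; simp
    | zero => simp
    | add k l _ _ hk hl => rw [mul_add, hk, hl, add_zero]
    | smul t k _ hk => rw [mul_smul_comm, hk, smul_zero]
  have h4 : π e * π a = 0 := by
    have hc : IsClosed {k : H →L[ℂ] H | π e * k = 0} :=
      isClosed_eq (by fun_prop) continuous_const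
    exact closure_minimal (fun k hk => h3 k hk) hc ha
  rw [← map_mul] at h4
  have h5 : e * a = 0 := hfaith (by rw [h4, map_zero])
  have := congrArg (fun q : C₀(X, ℂ) => q x) h5
  simpa [e1] using this

lemma kat_off {X : Type*} [TopologicalSpace X] [LocallyCompactSpace X] [T2Space X]
    (Δ : Set X)
    {H : Type*} [NormedAddCommGroup H] [InnerProductSpace ℂ H] [CompleteSpace H]
    (π : C₀(X, ℂ) →⋆ₙₐ[ℂ] (H →L[ℂ] H)) (T : H →L[ℂ] H)
    (hfaith : Function.Injective ⇑π) (a : C₀(X, ℂ))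
    (ha : π a ∈ closure (katSpan Δ π T : Set (H →L[ℂ] H)))
    (x : X) (hx : x ∉ Δ) : a x = 0 := by
  have h3 : ∀ k ∈ katSpan Δ π T, ∀ δ > 0, ∃ U : Set X, IsOpen U ∧ x ∈ U ∧ 
      ∀ e : C₀(X, ℂ), (∀ z ∉ U, e z = 0) → (∀ z, ‖e z‖ ≤ 1) → ‖π e * k‖ ≤ δ := by
    intro k hk
    induction hk using Submodule.span_induction with
    | mem k hk =>
      obtain ⟨b, c, hb, -, rfl⟩ := hk
      intro δ hδ
      set R := ‖T * star T * π c‖ with hR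
      have hR0 : 0 ≤ R := norm_nonneg _
      refine ⟨{z | ‖b z‖ < δ / (R + 1)}, isOpen_lt (by fun_prop) continuous_const, ?_, ?_⟩
      · simp only [Set.mem_setOf_eq, hb x hx, norm_zero]; positivity
      intro e e0 e1
      have n1 : ‖e * b‖ ≤ δ / (R + 1) := by
        apply kat_norm_le _ _ (by positivity)
        intro z
        by_cases hz : ‖b z‖ < δ / (R + 1)
        · simp only [ZeroAtInftyContinuousMap.mul_apply, norm_mul]
          have : ‖e z‖ * ‖b z‖ ≤ 1 * ‖b z‖ := by gcongr; exact e1 z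
          linarith
        · simp [e0 z hz]; positivity
      have : π e * (π b * T * star T * π c) = π (e * b) * (T * star T * π c) := by
        rw [map_mul]; simp only [mul_assoc]
      rw [this]
      calc _ ≤ ‖π (e * b)‖ * R := norm_mul_le _ _
        _ ≤ δ / (R + 1) * (R + 1) := by
          rw [kat_iso π hfaith]; gcongr; linarith
        _ = δ := by field_simp
    | zero => exact fun δ hδ => ⟨Set.univ, isOpen_univ, trivial, fun e _ _ => by simpa using hδ.le⟩
    | add k l _ _ hk hl =>
      intro δ hδ
      obtain ⟨U, hU, hxU, h⟩ := hk (δ / 2) (by positivity)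
      obtain ⟨V, hV, hxV, h'⟩ := hl (δ / 2) (by positivity)
      refine ⟨U ∩ V, hU.inter hV, ⟨hxU, hxV⟩, fun e e0 e1 => ?_⟩
      have := h e (fun z hz => e0 z (fun q => hz q.1)) e1
      have := h' e (fun z hz => e0 z (fun q => hz q.2)) e1
      rw [mul_add]
      exact (norm_add_le _ _).trans (by linarith)
    | smul t k _ hk =>
      intro δ hδ
      obtain ⟨U, hU, hxU, h⟩ := hk (δ / (‖t‖ + 1)) (by positivity)
      refine ⟨U, hU, hxU, fun e e0 e1 => ?_⟩
      rw [mul_smul_comm, norm_smul]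
      calc _ ≤ (‖t‖ + 1) * (δ / (‖t‖ + 1)) := by
            gcongr
            · linarith
            · exact h e e0 e1
        _ = δ := by field_simp
  have key : ∀ ε > 0, ‖a x‖ ≤ 0 + ε := by
    intro ε hε
    obtain ⟨k, hk, hd⟩ := Metric.mem_closure_iff.1 ha (ε / 2) (by positivity)
    obtain ⟨U, hU, hxU, h⟩ := h3 k hk (ε / 2) (by positivity)
    obtain ⟨e, e1, e0, er⟩ := kat_bump U hU x hxU
    have hn := h e e0 (kat_abs e er)
    have h1 : ‖a x‖ ≤ ‖e * a‖ := by
      have := kat_le_norm (e * a) x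
      simpa [e1] using this
    have h2 : π (e * a) = π e * (π a - k) + π e * k := by
      rw [map_mul, mul_sub, sub_add_cancel]
    have h4 : ‖π e‖ ≤ 1 := by
      rw [kat_iso π hfaith]; exact kat_norm_le _ _ zero_le_one (kat_abs e er)
    rw [dist_eq_norm] at hd
    have h5 : ‖π e * (π a - k)‖ ≤ 1 * (ε / 2) :=
      (norm_mul_le _ _).trans (by gcongr)
    rw [← kat_iso π hfaith, h2] at h1
    have := norm_add_le (π e * (π a - k)) (π e * k)
    linarith
  have := le_of_forall_pos_le_add key
  simpa using this

lemma kat_zero {X : Type*} [TopologicalSpace X] [LocallyCompactSpace X] [T2Space X]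
    (Δ : Set X) (φ : X → X) (ρ : X → ℝ) (M : ℝ) (hΔ : IsOpen Δ) (hφ : ContinuousOn φ Δ)
    (hpot : IsPotential Δ φ ρ M)
    {H : Type*} [NormedAddCommGroup H] [InnerProductSpace ℂ H] [CompleteSpace H]
    (π : C₀(X, ℂ) →⋆ₙₐ[ℂ] (H →L[ℂ] H)) (T : H →L[ℂ] H) (hrep : IsRep Δ φ ρ π T)
    (hfaith : Function.Injective ⇑π) (a : C₀(X, ℂ))
    (ha : π a ∈ closure (katSpan Δ π T : Set (H →L[ℂ] H)))
    (x : X) (hx : x ∈ Δ) (hρ : ρ x = 0) : a x = 0 := by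
  have usc : Tendsto ρ (𝓝 x) (𝓝 0) := by
    rw [Metric.tendsto_nhds]
    intro δ hδ
    obtain ⟨f, hf⟩ := kat_net Δ φ hΔ x hx
    have t := kat_conv Δ φ ρ M hpot x hx f hf f 1
      (fun F z => kat_abs (f F) (hf.2.2.1 F) z) 1 hf.1
    rw [hρ, Complex.ofReal_zero, zero_mul] at t
    obtain ⟨F, hF⟩ := ((Metric.tendsto_nhds.1 t) (δ / 4) (by positivity)).exists
    obtain ⟨d, hd⟩ := hpot.2.2.2 (f F * f F) (fun z hz => by simp [hf.2.1 F z hz])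
    rw [← hd, dist_zero_right] at hF
    have c1 : ContinuousAt (fun z => ‖d (φ z)‖) x :=
      ((map_continuous d).continuousAt.comp (hφ.continuousAt (hΔ.mem_nhds hx))).norm
    have c2 : ContinuousAt (fun z => ‖(f F * f F) z‖) x := by fun_prop
    filter_upwards [c1.eventually_lt_const hF, c2.eventually_const_lt (u := 1 / 2)
      (by simp [hf.1]; norm_num), hΔ.mem_nhds hx] with z h1 h2 hz
    choose r r0 r1 hr using hf.2.2.1 F
    have hn : 0 ≤ ρ z := hpot.1 z hz
    have e1 : d (φ z) = ((∑' w : Fiber Δ φ (φ z), ρ w.1 * (r w.1 * r w.1) : ℝ) : ℂ) := by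
      rw [hd, Complex.ofReal_tsum]
      congr 1; ext w
      simp [hr]
    have hnn : ∀ w : Fiber Δ φ (φ z), 0 ≤ ρ w.1 * (r w.1 * r w.1) := fun w =>
      mul_nonneg (hpot.1 _ w.2.1) (mul_self_nonneg _)
    have hsum : Summable fun w : Fiber Δ φ (φ z) => ρ w.1 * (r w.1 * r w.1) := by
      refine Summable.of_nonneg_of_le hnn (fun w => ?_) (hpot.2.1 (φ z))
      have h1 : r w.1 * r w.1 ≤ 1 := mul_le_one₀ (r1 _) (r0 _) (r1 _)
      exact mul_le_of_le_one_right (hpot.1 _ w.2.1) h1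
    have h3 := hsum.le_tsum (⟨z, hz, rfl⟩ : Fiber Δ φ (φ z)) (fun w _ => hnn w)
    rw [e1, Complex.norm_real, Real.norm_of_nonneg (tsum_nonneg hnn)] at h1
    rw [ZeroAtInftyContinuousMap.mul_apply, hr, ← Complex.ofReal_mul, Complex.norm_real,
      Real.norm_of_nonneg (mul_self_nonneg _)] at h2
    rw [Real.dist_eq, sub_zero, abs_of_nonneg hn]
    have h4 : ρ z * (1 / 2) ≤ ρ z * (r z * r z) := by gcongr
    dsimp only at h3
    linarith
  by_contra hne
  have hm : 0 < ‖a x‖ := norm_pos_iff.2 hne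
  obtain ⟨g, -, hg⟩ := kat_approx Δ φ ρ M hΔ hpot π T hrep hfaith a ha (‖a x‖ / 4) (by positivity)
  have c1 : Tendsto (fun z => ‖(ρ z * g z : ℂ)‖) (𝓝 x) (𝓝 ‖((0 : ℝ) * g x : ℂ)‖) :=
    (((Complex.continuous_ofReal.tendsto 0).comp usc).mul (map_continuous g).continuousAt).norm
  have c2 : ContinuousAt (fun z => ‖a z‖) x := by fun_prop
  have ev : ∀ᶠ z in 𝓝 x, z ∈ Δ ∧ ρ z = 0 := by
    filter_upwards [c1.eventually_lt_const (u := ‖a x‖ / 4) (by simpa using hne),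
      c2.eventually_const_lt (u := ‖a x‖ / 2) (by linarith), hΔ.mem_nhds hx] with z h1 h2 hz
    refine ⟨hz, ?_⟩
    by_contra hz0
    have h3 := hg z hz (lt_of_le_of_ne (hpot.1 z hz) (Ne.symm hz0))
    have := norm_sub_norm_le (a z) (ρ z * g z)
    linarith
  obtain ⟨U, hU, hUo, hxU⟩ := mem_nhds_iff.1 ev
  exact hne (kat_zero_int Δ φ ρ π T hrep hfaith a ha U hUo (fun z hz => (hU hz).1)
    (fun z hz => (hU hz).2) x hxU)

end helpers

/-- If `(π, T)` is a faithful representation of `L` and `π(a)` lies in the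
closed linear span of `{π(b) T T* π(c) : b, c ∈ C₀(Δ)}`, then `a` vanishes outside `Δ_reg`. -/
theorem katsura_ideal_inclusion
    {X : Type*} [TopologicalSpace X] [LocallyCompactSpace X] [T2Space X]
    (Δ : Set X) (φ : X → X) (ρ : X → ℝ) (M : ℝ)
    (hΔ : IsOpen Δ) (hφ : ContinuousOn φ Δ)
    (hcount : ∀ y : X, (Fiber Δ φ y).Countable)
    (hpot : IsPotential Δ φ ρ M)
    {H : Type*} [NormedAddCommGroup H] [InnerProductSpace ℂ H] [CompleteSpace H]
    (π : C₀(X, ℂ) →⋆ₙₐ[ℂ] (H →L[ℂ] H)) (T : H →L[ℂ] H)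
    (hrep : IsRep Δ φ ρ π T) (hfaith : Function.Injective ⇑π)
    (a : C₀(X, ℂ))
    (ha : π a ∈ closure (↑(Submodule.span ℂ {x : H →L[ℂ] H | ∃ b c : C₀(X, ℂ),
      (∀ z ∉ Δ, b z = 0) ∧ (∀ z ∉ Δ, c z = 0) ∧ x = π b * T * star T * π c}) :
        Set (H →L[ℂ] H))) :
    ∀ x ∉ Dreg Δ ρ, a x = 0 := by
  intro x hx
  by_cases hxΔ : x ∈ Δ
  swap
  · exact kat_off Δ π T hfaith a ha x hxΔ
  by_contra hne
  have hρ : 0 < ρ x := lt_of_le_of_ne (hpot.1 x hxΔ) (fun h => hne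
    (kat_zero Δ φ ρ M hΔ hφ hpot π T hrep hfaith a ha x hxΔ h.symm))
  apply hx
  refine ⟨hxΔ, hρ, ?_⟩
  have hm : 0 < ‖a x‖ := norm_pos_iff.2 hne
  have hM : ∀ z ∈ Δ, ρ z ≤ M := fun z hz =>
    ((hpot.2.1 (φ z)).le_tsum (⟨z, hz, rfl⟩ : Fiber Δ φ (φ z))
      (fun w _ => hpot.1 _ w.2.1)).trans (hpot.2.2.1 _)
  have hM0 : 0 < M := hρ.trans_le (hM x hxΔ)
  rw [Metric.continuousWithinAt_iff']
  intro δ hδ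
  obtain ⟨ε, hε, hε1, hε2⟩ : ∃ ε > 0, ε ≤ ‖a x‖ / 2 ∧ ρ x * (5 * ε) ≤ δ * (‖a x‖ / 2) := by
    refine ⟨min (‖a x‖ / 2) (δ * (‖a x‖ / 2) / (5 * ρ x)), by positivity, min_le_left _ _, ?_⟩
    calc _ ≤ ρ x * (5 * (δ * (‖a x‖ / 2) / (5 * ρ x))) := by gcongr; exact min_le_right _ _
      _ = _ := by field_simp
  obtain ⟨g, -, hg⟩ := kat_approx Δ φ ρ M hΔ hpot π T hrep hfaith a ha ε hε
  have hg' : ∀ z ∈ Δ, ‖a z - ρ z * g z‖ ≤ ε := by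
    intro z hz
    rcases (hpot.1 z hz).eq_or_lt with h | h
    · rw [kat_zero Δ φ ρ M hΔ hφ hpot π T hrep hfaith a ha z hz h.symm, ← h]
      simpa using hε.le
    · exact hg z hz h
  have c1 : ContinuousAt (fun z => ‖a z - a x‖) x := by fun_prop
  have c2 : ContinuousAt (fun z => M * ‖g x - g z‖) x := by fun_prop
  filter_upwards [mem_nhdsWithin_of_mem_nhds (c1.eventually_lt_const (u := ε) (by simpa using hε)),
    mem_nhdsWithin_of_mem_nhds (c2.eventually_lt_const (u := ε) (by simpa using hε)),
    self_mem_nhdsWithin] with z h1 h2 hz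
  have h3 := hg' z hz
  have h4 := hg' x hxΔ
  have hz0 := hpot.1 z hz
  have e : ((ρ z - ρ x : ℝ) : ℂ) * g x = ρ z * (g x - g z) + (a z - a x) - (a z - ρ z * g z)
      + (a x - ρ x * g x) := by push_cast; ring
  have n1 : |ρ z - ρ x| * ‖g x‖ ≤ 4 * ε := by
    have q := congrArg norm e
    rw [norm_mul, Complex.norm_real, Real.norm_eq_abs] at q
    rw [q]
    have k1 := norm_add_le (ρ z * (g x - g z) + (a z - a x) - (a z - ρ z * g z)) (a x - ρ x * g x)
    have k2 := norm_sub_le (ρ z * (g x - g z) + (a z - a x)) (a z - ρ z * g z)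
    have k3 := norm_add_le (ρ z * (g x - g z)) (a z - a x)
    have k4 : ‖(ρ z * (g x - g z) : ℂ)‖ ≤ M * ‖g x - g z‖ := by
      rw [norm_mul, Complex.norm_real, Real.norm_of_nonneg hz0]
      gcongr
      exact hM z hz
    linarith
  have n2 : ‖a x‖ / 2 ≤ ρ x * ‖g x‖ := by
    have k := norm_sub_norm_le (a x) (ρ x * g x)
    rw [norm_mul, Complex.norm_real, Real.norm_of_nonneg hρ.le] at k
    linarith
  rw [Real.dist_eq]
  have n3 : |ρ z - ρ x| * (‖a x‖ / 2) < δ * (‖a x‖ / 2) := by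
    calc _ ≤ |ρ z - ρ x| * (ρ x * ‖g x‖) := by gcongr
      _ = ρ x * (|ρ z - ρ x| * ‖g x‖) := by ring
      _ ≤ ρ x * (4 * ε) := by gcongr
      _ < ρ x * (5 * ε) := by gcongr; norm_num
      _ ≤ _ := hε2
  exact lt_of_mul_lt_mul_right n3 (by positivity)
end
end

section
/- Let (π, T) be a representation of L on a Hilbert space H. For n ≥ 0 set E_n := the closed linear span of {π(a)Tⁿ : a ∈ C₀(Δ_n)} in B(H) (so E₀ = π(C₀(X))), K₀ := π(C₀(X)), and K_n := the closed linear span of {e f* : e, f ∈ E_n}. Then for all n, m ≥ 1: (1) the closed linear span of {e k : e ∈ E_n, k ∈ K₀} equals E_n, and e* f ∈ K₀ for all e, f ∈ E_n; (2) the closed linear span of {e f : e ∈ E_n, f ∈ E_m} equals E_{n+m}; (3) K_n is closed under multiplication and adjoints (a C*-subalgebra of B(H)) and the closed linear span of {k e : k ∈ K_n, e ∈ E_n} equals E_n; (4) if n ≤ m then the closed linear span of {k k' : k ∈ K_n, k' ∈ K_m} equals K_m. -/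
open scoped ZeroAtInfty

noncomputable section

variable {X : Type*} [TopologicalSpace X]

/-- `Δ_n`: the natural domain of `φⁿ`. -/
def Dn (Δ : Set X) (φ : X → X) (n : ℕ) : Set X := {x | ∀ k < n, φ^[k] x ∈ Δ}

/-- `ρ_n(x) = Π_{i=0}^{n-1} ρ(φⁱ(x))`, the cocycle generated by `ρ`. -/
def rhon (φ : X → X) (ρ : X → ℝ) (n : ℕ) (x : X) : ℝ :=
  ∏ i ∈ Finset.range n, ρ (φ^[i] x)

/-- The fibre of `φⁿ` over `y`. -/
def Fibern (Δ : Set X) (φ : X → X) (n : ℕ) (y : X) : Set X :=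
  {x | x ∈ Dn Δ φ n ∧ φ^[n] x = y}

variable {H : Type*} [NormedAddCommGroup H] [InnerProductSpace ℂ H] [CompleteSpace H]

/-- `E_n`: the closed linear span of `{π(a) Tⁿ : a ∈ C₀(Δ_n)}`. -/
def Espace (Δ : Set X) (φ : X → X) (π : C₀(X, ℂ) →⋆ₙₐ[ℂ] (H →L[ℂ] H))
    (T : H →L[ℂ] H) (n : ℕ) : Set (H →L[ℂ] H) :=
  closure (↑(Submodule.span ℂ {S : H →L[ℂ] H | ∃ a : C₀(X, ℂ),
    (∀ x ∉ Dn Δ φ n, a x = 0) ∧ S = π a * T ^ n}) : Set (H →L[ℂ] H))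

/-- `K_n` (for `n ≥ 1`): the closed linear span of `{e f* : e, f ∈ E_n}`. -/
def Kspace (Δ : Set X) (φ : X → X) (π : C₀(X, ℂ) →⋆ₙₐ[ℂ] (H →L[ℂ] H))
    (T : H →L[ℂ] H) (n : ℕ) : Set (H →L[ℂ] H) :=
  closure (↑(Submodule.span ℂ {S : H →L[ℂ] H | ∃ e ∈ Espace Δ φ π T n,
    ∃ f ∈ Espace Δ φ π T n, S = e * star f}) : Set (H →L[ℂ] H))

open Filter Topology

/-- Closed linear span, as a submodule. -/
def csp (s : Set (H →L[ℂ] H)) : Submodule ℂ (H →L[ℂ] H) := (Submodule.span ℂ s).topologicalClosure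

theorem csp_closed (s : Set (H →L[ℂ] H)) : IsClosed (csp s : Set (H →L[ℂ] H)) :=
  Submodule.isClosed_topologicalClosure _

theorem sub_csp {s : Set (H →L[ℂ] H)} {x : H →L[ℂ] H} (hx : x ∈ s) : x ∈ csp s :=
  Submodule.le_topologicalClosure _ (Submodule.subset_span hx)

theorem csp_le {s : Set (H →L[ℂ] H)} {P : Submodule ℂ (H →L[ℂ] H)}
    (hP : IsClosed (P : Set (H →L[ℂ] H))) (h : ∀ x ∈ s, x ∈ P) : csp s ≤ P :=
  Submodule.topologicalClosure_minimal _ (Submodule.span_le.2 h) hP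

theorem csp_map {s : Set (H →L[ℂ] H)} {P : Submodule ℂ (H →L[ℂ] H)}
    (hP : IsClosed (P : Set (H →L[ℂ] H))) (f : (H →L[ℂ] H) →L[ℂ] (H →L[ℂ] H))
    (h : ∀ x ∈ s, f x ∈ P) : ∀ x ∈ csp s, f x ∈ P := by
  have : csp s ≤ P.comap (f : (H →L[ℂ] H) →ₗ[ℂ] (H →L[ℂ] H)) :=
    csp_le (hP.preimage f.continuous) h
  exact fun x hx => this hx

theorem csp_mul_right {s : Set (H →L[ℂ] H)} {P : Submodule ℂ (H →L[ℂ] H)}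
    (hP : IsClosed (P : Set (H →L[ℂ] H))) (y : H →L[ℂ] H)
    (h : ∀ x ∈ s, x * y ∈ P) : ∀ x ∈ csp s, x * y ∈ P :=
  csp_map hP ((ContinuousLinearMap.mul ℂ (H →L[ℂ] H)).flip y) h

theorem csp_mul_left {s : Set (H →L[ℂ] H)} {P : Submodule ℂ (H →L[ℂ] H)}
    (hP : IsClosed (P : Set (H →L[ℂ] H))) (y : H →L[ℂ] H)
    (h : ∀ x ∈ s, y * x ∈ P) : ∀ x ∈ csp s, y * x ∈ P :=
  csp_map hP ((ContinuousLinearMap.mul ℂ (H →L[ℂ] H)) y) h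

theorem csp_mul {s t : Set (H →L[ℂ] H)} {P : Submodule ℂ (H →L[ℂ] H)}
    (hP : IsClosed (P : Set (H →L[ℂ] H)))
    (h : ∀ x ∈ s, ∀ y ∈ t, x * y ∈ P) : ∀ x ∈ csp s, ∀ y ∈ csp t, x * y ∈ P :=
  fun x hx y hy => csp_mul_right hP y (fun x hx => csp_mul_left hP x (h x hx) y hy) x hx

theorem csp_star {s : Set (H →L[ℂ] H)} {P : Submodule ℂ (H →L[ℂ] H)}
    (hP : IsClosed (P : Set (H →L[ℂ] H)))
    (h : ∀ x ∈ s, star x ∈ P) : ∀ x ∈ csp s, star x ∈ P := by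
  have : csp s ≤ P.comap ((starLinearEquiv ℂ (A := H →L[ℂ] H)).toLinearMap) :=
    csp_le (hP.preimage continuous_star) h
  exact fun x hx => this hx

theorem mem_of_approx {P : Submodule ℂ (H →L[ℂ] H)} (hP : IsClosed (P : Set (H →L[ℂ] H)))
    {x : H →L[ℂ] H} (C : ℝ) (h : ∀ ε > 0, ∃ y ∈ P, ‖x - y‖ ≤ ε * C) : x ∈ P := by
  have : x ∈ closure (P : Set (H →L[ℂ] H)) := by
    rw [Metric.mem_closure_iff]
    intro ε hε
    have hC : 0 < |C| + 1 := by positivity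
    obtain ⟨y, hy, hxy⟩ := h (ε / 2 / (|C| + 1)) (by positivity)
    refine ⟨y, hy, ?_⟩
    rw [dist_eq_norm]
    have h1 : ε / 2 / (|C| + 1) * C ≤ ε / 2 / (|C| + 1) * (|C| + 1) := by
      gcongr
      linarith [le_abs_self C]
    rw [div_mul_cancel₀ _ hC.ne'] at h1
    linarith
  rwa [hP.closure_eq] at this

theorem c0_norm_le {f : C₀(X, ℂ)} {C : ℝ} (hC : 0 ≤ C) (h : ∀ x, ‖f x‖ ≤ C) : ‖f‖ ≤ C := by
  rw [← ZeroAtInftyContinuousMap.norm_toBCF_eq_norm]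
  exact (BoundedContinuousFunction.norm_le hC).2 h

theorem c0_apply_le (f : C₀(X, ℂ)) (x : X) : ‖f x‖ ≤ ‖f‖ := by
  rw [← ZeroAtInftyContinuousMap.norm_toBCF_eq_norm]
  exact f.toBCF.norm_coe_le_norm x

/-- a continuous function dominated by a C₀ function is C₀ -/
theorem exists_c0 (a : C₀(X, ℂ)) (f : X → ℂ) (hf : Continuous f) (C : ℝ)
    (h : ∀ x, ‖f x‖ ≤ C * ‖a x‖) : ∃ c : C₀(X, ℂ), ∀ x, c x = f x := by
  refine ⟨⟨⟨f, hf⟩, ?_⟩, fun x => rfl⟩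
  refine squeeze_zero_norm h ?_
  simpa using ((a.zero_at_infty').norm.const_mul C)

theorem exists_mul_comp (a b : C₀(X, ℂ)) (U : Set X) (hU : IsOpen U) (ψ : X → X)
    (hψ : ContinuousOn ψ U) (ha : ∀ x ∉ U, a x = 0) :
    ∃ c : C₀(X, ℂ), ∀ x, c x = a x * b (ψ x) := by
  have hb : ∀ x, ‖a x * b (ψ x)‖ ≤ ‖b‖ * ‖a x‖ := by
    intro x
    rw [norm_mul, mul_comm]
    gcongr
    exact c0_apply_le b _
  refine exists_c0 a _ ?_ ‖b‖ hb
  rw [continuous_iff_continuousAt]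
  intro x
  have hac : Continuous a := map_continuous a
  have hbc : Continuous b := map_continuous b
  by_cases hx : x ∈ U
  · exact hac.continuousAt.mul (hbc.continuousAt.comp (hψ.continuousAt (hU.mem_nhds hx)))
  · rw [ContinuousAt, ha x hx, zero_mul]
    refine squeeze_zero_norm hb ?_
    have := (hac.norm.const_mul ‖b‖).tendsto x
    simpa [ha x hx] using this

theorem range_closed (π : C₀(X, ℂ) →⋆ₙₐ[ℂ] (H →L[ℂ] H)) : IsClosed (Set.range ⇑π) := by
  let f : NormedAddGroupHom C₀(X, ℂ) (H →L[ℂ] H) :=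
    { toFun := π
      map_add' := map_add π
      bound' := ⟨1, fun a => by simpa using NonUnitalStarAlgHom.norm_apply_le π a⟩ }
  have hπc : Continuous π := f.continuous
  have key : f.SurjectiveOnWith f.range 1 := by
    intro b hb
    obtain ⟨a, rfl⟩ := (f.mem_range _).1 hb
    change ∃ g, π g = π a ∧ ‖g‖ ≤ 1 * ‖π a‖
    rcases (norm_nonneg (π a)).eq_or_lt with h0 | h0
    · exact ⟨0, by rw [map_zero]; exact (norm_eq_zero.1 h0.symm).symm, by simp⟩
    set R := ‖π a‖ with hR
    let r : ℂ → ℂ := fun z => z * ((R / max R ‖z‖ : ℝ) : ℂ)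
    have hpos : ∀ z : ℂ, 0 < max R ‖z‖ := fun z => lt_max_of_lt_left h0
    have hr : Continuous r := by
      refine continuous_id.mul (Complex.continuous_ofReal.comp ?_)
      exact continuous_const.div (continuous_const.max continuous_norm) fun z => (hpos z).ne'
    have hr0 : r 0 = 0 := by simp [r]
    have hrn : ∀ z, ‖r z‖ ≤ R := by
      intro z
      simp only [r, norm_mul, Complex.norm_real, Real.norm_eq_abs]
      rw [abs_of_nonneg (div_nonneg h0.le (hpos z).le), mul_div_assoc', div_le_iff₀ (hpos z),
        mul_comm]
      gcongr
      exact le_max_right _ _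
    have han : IsStarNormal a := ⟨mul_comm _ _⟩
    have hπan : IsStarNormal (π a) := ⟨by
      rw [← map_star]
      exact (show Commute (star a) a from mul_comm (star a) a).map π⟩
    refine ⟨cfcₙ r a, ?_, ?_⟩
    · rw [NonUnitalStarAlgHomClass.map_cfcₙ (S := ℂ) π r a hr.continuousOn hr0 hπc han hπan]
      conv_rhs => rw [← cfcₙ_id' ℂ (π a)]
      refine cfcₙ_congr fun z hz => ?_
      have hz' : ‖z‖ ≤ R := by
        have := norm_apply_le_norm_cfcₙ (id : ℂ → ℂ) (π a) hz
        rwa [cfcₙ_id ℂ (π a)] at this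
      have h0' : (R : ℂ) ≠ 0 := by exact_mod_cast h0.ne'
      simp [r, max_eq_left hz', h0']
    · rw [one_mul]
      exact norm_cfcₙ_le fun z _ => hrn z
  have h2 := controlled_closure_of_complete one_pos one_pos key
  rw [← closure_subset_iff_isClosed]
  intro b hb
  obtain ⟨g, hg, -⟩ := h2 b hb
  exact ⟨g, hg⟩

theorem Dn_succ (Δ : Set X) (φ : X → X) (n : ℕ) (x : X) :
    x ∈ Dn Δ φ (n + 1) ↔ x ∈ Δ ∧ φ x ∈ Dn Δ φ n := by
  constructor
  · intro h
    exact ⟨h 0 (by omega), fun k hk => h (k + 1) (by omega)⟩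
  · rintro ⟨h0, h⟩ k hk
    cases k with
    | zero => exact h0
    | succ k => exact h k (by omega)

theorem Dn_add (Δ : Set X) (φ : X → X) (n m : ℕ) (x : X) :
    x ∈ Dn Δ φ (n + m) ↔ x ∈ Dn Δ φ n ∧ φ^[n] x ∈ Dn Δ φ m := by
  constructor
  · intro h
    refine ⟨fun k hk => h k (by omega), fun k hk => ?_⟩
    rw [← Function.iterate_add_apply]
    exact h _ (by omega)
  · rintro ⟨h0, h⟩ k hk
    by_cases hkn : k < n
    · exact h0 k hkn
    · have := h (k - n) (by omega)
      rwa [← Function.iterate_add_apply, Nat.sub_add_cancel (by omega)] at this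

theorem Dn_top (Δ : Set X) (φ : X → X) (hΔ : IsOpen Δ) (hφ : ContinuousOn φ Δ) (n : ℕ) :
    IsOpen (Dn Δ φ n) ∧ ContinuousOn (φ^[n]) (Dn Δ φ n) := by
  induction n with
  | zero =>
    have : Dn Δ φ 0 = Set.univ := by ext x; simp [Dn]
    rw [this]
    exact ⟨isOpen_univ, continuousOn_id⟩
  | succ n ih =>
    have : Dn Δ φ (n + 1) = Δ ∩ φ ⁻¹' Dn Δ φ n := by ext x; exact Dn_succ Δ φ n x
    rw [this]
    refine ⟨hφ.isOpen_inter_preimage hΔ ih.1, ?_⟩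
    rw [Function.iterate_succ]
    exact ih.2.comp (hφ.mono Set.inter_subset_left) fun x hx => hx.2

theorem iter_L (Δ : Set X) (φ : X → X) (ρ : X → ℝ) (M : ℝ)
    (hpot : IsPotential Δ φ ρ M) (π : C₀(X, ℂ) →⋆ₙₐ[ℂ] (H →L[ℂ] H)) (T : H →L[ℂ] H)
    (hrep : IsRep Δ φ ρ π T) (n : ℕ) : ∀ a : C₀(X, ℂ), (∀ x ∉ Dn Δ φ n, a x = 0) →
    ∃ g : C₀(X, ℂ), star (T ^ n) * π a * T ^ n = π g ∧
      ∀ b c : C₀(X, ℂ), (∀ x, c x = a x * b (φ^[n] x)) →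
        star (T ^ n) * π c * T ^ n = π (g * b) := by
  induction n with
  | zero =>
    intro a _
    refine ⟨a, by simp, fun b c hc => ?_⟩
    have : c = a * b := by ext x; simpa using hc x
    simp [this]
  | succ n ih =>
    intro a ha
    have haΔ : ∀ x ∉ Δ, a x = 0 := fun x hx => ha x fun h => hx ((Dn_succ Δ φ n x).1 h).1
    obtain ⟨a', ha'⟩ := hpot.2.2.2 a haΔ
    have hT : ∀ z, star (T ^ (n + 1)) * z * T ^ (n + 1) =
        star (T ^ n) * (star T * z * T) * T ^ n := by
      intro z
      rw [pow_succ' T n, star_mul]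
      simp only [mul_assoc]
    have ha'0 : ∀ y ∉ Dn Δ φ n, a' y = 0 := by
      intro y hy
      rw [ha' y]
      convert tsum_zero with x
      have : a x.1 = 0 := ha _ fun h => hy (by
        have := ((Dn_succ Δ φ n _).1 h).2
        rwa [x.2.2] at this)
      rw [this, mul_zero]
    obtain ⟨g, hg1, hg2⟩ := ih a' ha'0
    refine ⟨g, ?_, fun b c hc => ?_⟩
    · rw [hT, ← hrep.2 a a' haΔ ha', hg1]
    · have hcΔ : ∀ x ∉ Δ, c x = 0 := fun x hx => by rw [hc, haΔ x hx, zero_mul]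
      obtain ⟨c', hc'⟩ := hpot.2.2.2 c hcΔ
      rw [hT, ← hrep.2 c c' hcΔ hc']
      refine hg2 b c' fun y => ?_
      rw [hc', ha', ← tsum_mul_right]
      congr 1
      ext x
      rw [hc, Function.iterate_succ_apply, x.2.2, mul_assoc]

theorem commute_T (Δ : Set X) (φ : X → X) (ρ : X → ℝ) (M : ℝ)
    (hpot : IsPotential Δ φ ρ M) (π : C₀(X, ℂ) →⋆ₙₐ[ℂ] (H →L[ℂ] H)) (T : H →L[ℂ] H)
    (hrep : IsRep Δ φ ρ π T) (n : ℕ) (a b c : C₀(X, ℂ)) (ha : ∀ x ∉ Dn Δ φ n, a x = 0)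
    (hc : ∀ x, c x = a x * b (φ^[n] x)) :
    π a * T ^ n * π b = π c * T ^ n := by
  obtain ⟨g, hg, hgb⟩ := iter_L Δ φ ρ M hpot π T hrep n (star a * a)
    (fun x hx => by simp [ha x hx])
  have e1 : star (T ^ n) * π (star a * c) * T ^ n = π (g * b) :=
    hgb b _ fun x => by simp [hc]; ring
  have e2 : star (T ^ n) * π (star c * a) * T ^ n = π (g * star b) :=
    hgb (star b) _ fun x => by simp [hc]; ring
  have e3 : star (T ^ n) * π (star c * c) * T ^ n = π (g * (star b * b)) :=
    hgb (star b * b) _ fun x => by simp [hc]; ring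
  rw [← sub_eq_zero, ← CStarRing.star_mul_self_eq_zero_iff]
  simp only [map_mul, map_star] at hg e1 e2 e3
  have c1 : π (star b) * π g = π g * π (star b) := by rw [← map_mul, mul_comm, map_mul]
  rw [map_star] at c1
  have : star (π a * T ^ n * π b - π c * T ^ n) * (π a * T ^ n * π b - π c * T ^ n) =
      star (π b) * (star (T ^ n) * (star (π a) * π a) * T ^ n) * π b
      - star (π b) * (star (T ^ n) * (star (π a) * π c) * T ^ n)
      - (star (T ^ n) * (star (π c) * π a) * T ^ n) * π b
      + star (T ^ n) * (star (π c) * π c) * T ^ n := by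
    simp only [star_sub, star_mul, sub_mul, mul_sub, mul_assoc]
    abel
  rw [this, hg, e1, e2, e3, c1, ← mul_assoc (star (π b)) (π g), c1]
  simp only [mul_assoc]
  abel

/-- approximate unit -/
theorem exists_cutoff [LocallyCompactSpace X] [T2Space X] (a : C₀(X, ℂ)) (U V : Set X)
    (ψ : X → X) (hψ : ContinuousOn ψ U) (hV : IsOpen V)
    (ha : ∀ x, a x ≠ 0 → x ∈ U ∧ ψ x ∈ V) (ε : ℝ) (hε : 0 < ε) :
    ∃ u : C₀(X, ℂ), (∀ x ∉ V, u x = 0) ∧ ∀ x, ‖a x - a x * u (ψ x)‖ ≤ ε := by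
  have hac : Continuous a := map_continuous a
  have hK : IsCompact {x | ε ≤ ‖a x‖} := by
    have h1 : ∀ᶠ x in cocompact X, ‖a x‖ < ε := by
      have := (a.zero_at_infty').norm
      rw [norm_zero] at this
      exact this.eventually_lt_const hε
    obtain ⟨t, ht, hts⟩ := mem_cocompact.1 h1
    refine ht.of_isClosed_subset (isClosed_le continuous_const hac.norm) fun x hx => ?_
    by_contra hxt
    have h2 : ‖a x‖ < ε := hts hxt
    have h3 : ε ≤ ‖a x‖ := hx
    linarith
  have hne : ∀ x ∈ {x | ε ≤ ‖a x‖}, a x ≠ 0 := fun x hx h => by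
    simp only [Set.mem_ofPred_eq, h, norm_zero] at hx
    linarith
  have hK2 : IsCompact (ψ '' {x | ε ≤ ‖a x‖}) :=
    hK.image_of_continuousOn (hψ.mono fun x hx => (ha x (hne x hx)).1)
  obtain ⟨f, hf1, hf2, hf3, hf4⟩ := exists_continuousMap_one_of_isCompact_subset_isOpen hK2 hV
    (by rintro _ ⟨x, hx, rfl⟩; exact (ha x (hne x hx)).2)
  have hfs : HasCompactSupport (fun x => (f x : ℂ)) :=
    HasCompactSupport.comp_left (g := fun t : ℝ => (t : ℂ)) (f := f) hf2 (by simp)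
  refine ⟨⟨⟨fun x => (f x : ℂ), Complex.continuous_ofReal.comp f.continuous⟩,
    hfs.is_zero_at_infty⟩, fun x hx => ?_, fun x => ?_⟩
  · change (f x : ℂ) = 0
    rw [image_eq_zero_of_notMem_tsupport fun h => hx (hf3 h), Complex.ofReal_zero]
  · change ‖a x - a x * (f (ψ x) : ℂ)‖ ≤ ε
    by_cases hx : ε ≤ ‖a x‖
    · have : f (ψ x) = 1 := hf1 ⟨x, hx, rfl⟩
      simp [this, hε.le]
    · have h4 := hf4 (ψ x)
      have : a x - a x * (f (ψ x) : ℂ) = a x * ((1 - f (ψ x) : ℝ) : ℂ) := by push_cast; ring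
      rw [this, norm_mul, Complex.norm_real, Real.norm_eq_abs, abs_of_nonneg (by linarith [h4.2])]
      nlinarith [norm_nonneg (a x), h4.1, h4.2]

/-- For `e` with `e* e = π g`, `e` is approximated by `e e* e π(h)`. -/
theorem cstar_approx (π : C₀(X, ℂ) →⋆ₙₐ[ℂ] (H →L[ℂ] H)) (e : H →L[ℂ] H) (g : C₀(X, ℂ))
    (hg : star e * e = π g) (ε : ℝ) (hε : 0 < ε) :
    ∃ h : C₀(X, ℂ), ‖e - e * star e * (e * π h)‖ ≤ ε := by
  set d : ℝ := ε ^ 2 with hd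
  have hdp : 0 < d := by positivity
  have hgc : Continuous g := map_continuous g
  have hden : ∀ x, 0 < ‖g x‖ ^ 2 + d ^ 2 := fun x => by positivity
  obtain ⟨h, hh⟩ := exists_c0 g (fun x => star (g x) * (((‖g x‖ ^ 2 + d ^ 2)⁻¹ : ℝ) : ℂ)) (by
      refine hgc.star.mul (Complex.continuous_ofReal.comp ?_)
      exact ((hgc.norm.pow 2).add continuous_const).inv₀ fun x => (hden x).ne') ((d ^ 2)⁻¹) (by
      intro x
      rw [norm_mul, norm_star, Complex.norm_real, Real.norm_eq_abs,
        abs_of_pos (inv_pos.2 (hden x)), mul_comm]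
      gcongr
      nlinarith [sq_nonneg ‖g x‖])
  refine ⟨h, ?_⟩
  set r := g * h with hr
  have hrx : ∀ x, r x = ((‖g x‖ ^ 2 / (‖g x‖ ^ 2 + d ^ 2) : ℝ) : ℂ) := by
    intro x
    have : g x * star (g x) = ((‖g x‖ ^ 2 : ℝ) : ℂ) := by
      rw [Complex.star_def, Complex.mul_conj, Complex.normSq_eq_norm_sq]
    rw [hr, ZeroAtInftyContinuousMap.mul_apply, hh, ← mul_assoc, this, div_eq_mul_inv]
    push_cast
    rfl
  have hrs : star r = r := by
    ext x
    rw [ZeroAtInftyContinuousMap.star_apply, hrx, Complex.star_def, Complex.conj_ofReal]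
  have hS : e * star e * (e * π h) = e * π r := by
    rw [hr, map_mul, ← hg]
    simp only [mul_assoc]
  rw [hS]
  have hrs' : star (π r) = π r := by rw [← map_star, hrs]
  have h2 : star (e - e * π r) * (e - e * π r) = π (g - r * g - g * r + r * g * r) := by
    have : star (e - e * π r) * (e - e * π r) = star e * e - π r * (star e * e)
        - (star e * e) * π r + π r * (star e * e) * π r := by
      rw [star_sub, star_mul, hrs']
      simp only [sub_mul, mul_sub, mul_assoc]
      abel
    rw [this, hg]
    simp only [map_add, map_sub, map_mul]
  have h3 : ‖g - r * g - g * r + r * g * r‖ ≤ d := by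
    refine c0_norm_le hdp.le fun x => ?_
    have : (g - r * g - g * r + r * g * r) x
        = g x * (((d ^ 2 / (‖g x‖ ^ 2 + d ^ 2)) ^ 2 : ℝ) : ℂ) := by
      simp only [ZeroAtInftyContinuousMap.add_apply, ZeroAtInftyContinuousMap.sub_apply,
        ZeroAtInftyContinuousMap.mul_apply]
      have : (d ^ 2 / (‖g x‖ ^ 2 + d ^ 2)) = 1 - ‖g x‖ ^ 2 / (‖g x‖ ^ 2 + d ^ 2) := by
        have := (hden x).ne'
        field_simp
        ring
      rw [this, Complex.ofReal_pow, Complex.ofReal_sub, ← hrx]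
      push_cast
      ring
    rw [this, norm_mul, Complex.norm_real, Real.norm_eq_abs, abs_of_nonneg (by positivity),
      div_pow, mul_div_assoc', div_le_iff₀ (pow_pos (hden x) 2)]
    have hs := norm_nonneg (g x)
    set s := ‖g x‖
    have e1 : s * d ≤ s ^ 2 + d ^ 2 := by nlinarith [sq_nonneg (s - d), mul_nonneg hs hdp.le]
    have e2 : d ^ 2 ≤ s ^ 2 + d ^ 2 := by nlinarith [sq_nonneg s]
    calc s * (d ^ 2) ^ 2 = d * ((s * d) * d ^ 2) := by ring
      _ ≤ d * ((s ^ 2 + d ^ 2) * (s ^ 2 + d ^ 2)) := by gcongr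
      _ = _ := by ring
  have h4 : ‖e - e * π r‖ * ‖e - e * π r‖ ≤ ε * ε := by
    rw [← CStarRing.norm_star_mul_self, h2]
    refine (NonUnitalStarAlgHom.norm_apply_le π _).trans (h3.trans ?_)
    rw [hd, sq]
  exact (mul_self_le_mul_self_iff (norm_nonneg _) hε.le).2 h4

/-- Basic structure of the spaces `E_n` and `K_n`. -/
theorem product_system_properties
    {X : Type*} [TopologicalSpace X] [LocallyCompactSpace X] [T2Space X]
    (Δ : Set X) (φ : X → X) (ρ : X → ℝ) (M : ℝ)
    (hΔ : IsOpen Δ) (hφ : ContinuousOn φ Δ)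
    (hcount : ∀ y : X, (Fiber Δ φ y).Countable)
    (hpot : IsPotential Δ φ ρ M)
    {H : Type*} [NormedAddCommGroup H] [InnerProductSpace ℂ H] [CompleteSpace H]
    (π : C₀(X, ℂ) →⋆ₙₐ[ℂ] (H →L[ℂ] H)) (T : H →L[ℂ] H)
    (hrep : IsRep Δ φ ρ π T)
    (n m : ℕ) (hn : 1 ≤ n) (hm : 1 ≤ m) :
    -- (1) `E_n K₀ = E_n` and `E_n* E_n ⊆ K₀`, where `K₀ = π(C₀(X))`
    (closure (↑(Submodule.span ℂ {S : H →L[ℂ] H | ∃ e ∈ Espace Δ φ π T n,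
        ∃ k ∈ Set.range ⇑π, S = e * k}) : Set (H →L[ℂ] H)) = Espace Δ φ π T n ∧
      ∀ e ∈ Espace Δ φ π T n, ∀ f ∈ Espace Δ φ π T n, star e * f ∈ Set.range ⇑π) ∧
    -- (2) `closure (E_n E_m) = E_{n+m}`
    (closure (↑(Submodule.span ℂ {S : H →L[ℂ] H | ∃ e ∈ Espace Δ φ π T n,
        ∃ f ∈ Espace Δ φ π T m, S = e * f}) : Set (H →L[ℂ] H)) = Espace Δ φ π T (n + m)) ∧
    -- (3) `K_n` is a C*-algebra and `K_n E_n = E_n`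
    ((∀ x ∈ Kspace Δ φ π T n, ∀ y ∈ Kspace Δ φ π T n, x * y ∈ Kspace Δ φ π T n) ∧
      (∀ x ∈ Kspace Δ φ π T n, star x ∈ Kspace Δ φ π T n) ∧
      closure (↑(Submodule.span ℂ {S : H →L[ℂ] H | ∃ k ∈ Kspace Δ φ π T n,
        ∃ e ∈ Espace Δ φ π T n, S = k * e}) : Set (H →L[ℂ] H)) = Espace Δ φ π T n) ∧
    -- (4) `n ≤ m → K_n K_m = K_m`
    (n ≤ m →
      closure (↑(Submodule.span ℂ {S : H →L[ℂ] H | ∃ k ∈ Kspace Δ φ π T n,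
        ∃ k' ∈ Kspace Δ φ π T m, S = k * k'}) : Set (H →L[ℂ] H)) = Kspace Δ φ π T m) := by
  set E : ℕ → Submodule ℂ (H →L[ℂ] H) := fun n => csp {S : H →L[ℂ] H | ∃ a : C₀(X, ℂ),
    (∀ x ∉ Dn Δ φ n, a x = 0) ∧ S = π a * T ^ n} with hE
  have hEc : ∀ n, IsClosed (E n : Set (H →L[ℂ] H)) := fun n => csp_closed _
  have hEs : ∀ n, Espace Δ φ π T n = E n := fun n => rfl
  set K : ℕ → Submodule ℂ (H →L[ℂ] H) := fun n => csp {S : H →L[ℂ] H |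
    ∃ e ∈ Espace Δ φ π T n, ∃ f ∈ Espace Δ φ π T n, S = e * star f} with hK
  have hKc : ∀ n, IsClosed (K n : Set (H →L[ℂ] H)) := fun n => csp_closed _
  have hKs : ∀ n, Kspace Δ φ π T n = K n := fun n => rfl
  have hgen : ∀ n (a : C₀(X, ℂ)), (∀ x ∉ Dn Δ φ n, a x = 0) → π a * T ^ n ∈ E n :=
    fun n a ha => sub_csp ⟨a, ha, rfl⟩
  have hKgen : ∀ n, ∀ e ∈ E n, ∀ f ∈ E n, e * star f ∈ K n :=
    fun n e he f hf => sub_csp ⟨e, he, f, hf, rfl⟩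
  let R : Submodule ℂ (H →L[ℂ] H) := LinearMap.range (π : C₀(X, ℂ) →ₗ[ℂ] (H →L[ℂ] H))
  have hR : ∀ S, S ∈ R ↔ S ∈ Set.range ⇑π := fun S => Iff.rfl
  have hRc : IsClosed (R : Set (H →L[ℂ] H)) := range_closed π
  have top := Dn_top Δ φ hΔ hφ
  have hcomm := commute_T Δ φ ρ M hpot π T hrep
  -- E_n E_m ⊆ E_{n+m}
  have hEE : ∀ n m, ∀ e ∈ E n, ∀ f ∈ E m, e * f ∈ E (n + m) := by
    intro n m
    refine csp_mul (hEc _) ?_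
    rintro _ ⟨a, ha, rfl⟩ _ ⟨b, hb, rfl⟩
    obtain ⟨c, hc⟩ := exists_mul_comp a b _ (top n).1 _ (top n).2 ha
    rw [← mul_assoc, hcomm n a b c ha hc, mul_assoc, ← pow_add]
    refine hgen _ c fun x hx => ?_
    rw [hc]
    by_cases h : x ∈ Dn Δ φ n
    · rw [hb _ fun h' => hx ((Dn_add Δ φ n m x).2 ⟨h, h'⟩), mul_zero]
    · rw [ha _ h, zero_mul]
  have hRE : ∀ b, π b ∈ E 0 := fun b => by
    have := hgen 0 b (fun x hx => absurd (fun k hk => absurd hk (Nat.not_lt_zero k)) hx)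
    simpa using this
  have hEK0 : ∀ n, ∀ e ∈ E n, ∀ b, e * π b ∈ E n := fun n e he b => hEE n 0 e he _ (hRE b)
  -- approximation
  have happ : ∀ n m (a : C₀(X, ℂ)), (∀ x ∉ Dn Δ φ (n + m), a x = 0) →
      ∀ P : Submodule ℂ (H →L[ℂ] H), IsClosed (P : Set (H →L[ℂ] H)) →
      (∀ u : C₀(X, ℂ), (∀ x ∉ Dn Δ φ m, u x = 0) → π a * T ^ n * (π u * T ^ m) ∈ P) →
      π a * T ^ (n + m) ∈ P := by
    intro n m a ha P hP hu
    refine mem_of_approx hP ‖T ^ (n + m)‖ fun ε hε => ?_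
    obtain ⟨u, hu1, hu2⟩ := exists_cutoff a (Dn Δ φ n) (Dn Δ φ m) (φ^[n]) (top n).2 (top m).1
      (fun x hx => (Dn_add Δ φ n m x).1 (by_contra fun h => hx (ha x h))) ε hε
    have ha' : ∀ x ∉ Dn Δ φ n, a x = 0 := fun x hx => ha x fun h => hx ((Dn_add Δ φ n m x).1 h).1
    refine ⟨_, hu u hu1, ?_⟩
    obtain ⟨c, hc⟩ := exists_mul_comp a u _ (top n).1 _ (top n).2 ha'
    rw [← mul_assoc, hcomm n a u c ha' hc, mul_assoc, ← pow_add, ← sub_mul, ← map_sub]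
    refine (norm_mul_le _ _).trans ?_
    gcongr
    refine (NonUnitalStarAlgHom.norm_apply_le π _).trans (c0_norm_le hε.le fun x => ?_)
    rw [ZeroAtInftyContinuousMap.sub_apply, hc]
    exact hu2 x
  -- E_n^* E_n ⊆ K_0
  have hstar : ∀ n, ∀ e ∈ E n, ∀ f ∈ E n, star e * f ∈ R := by
    intro n e he f hf
    have h1 : star e ∈ csp (star {S : H →L[ℂ] H | ∃ a : C₀(X, ℂ),
        (∀ x ∉ Dn Δ φ n, a x = 0) ∧ S = π a * T ^ n}) :=
      csp_star (csp_closed _) (fun x hx => sub_csp (by simpa using hx)) e he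
    refine csp_mul hRc ?_ _ h1 f hf
    rintro x ⟨a, ha, hx⟩ _ ⟨b, hb, rfl⟩
    obtain ⟨g, hg, -⟩ := iter_L Δ φ ρ M hpot π T hrep n (star a * b)
      (fun x hx => by simp [hb x hx])
    refine ⟨g, ?_⟩
    change π g = _
    rw [← star_star x, hx, ← hg, star_mul, map_mul, map_star]
    simp only [mul_assoc]
  -- E_n = closed span K_n E_n, pointwise forms
  have hKE : ∀ n, ∀ k ∈ K n, ∀ e ∈ E n, k * e ∈ E n := by
    intro n k hk e he
    refine csp_mul_right (hEc n) e ?_ k hk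
    rintro _ ⟨f, hf, g, hg, rfl⟩
    obtain ⟨b, hb⟩ := hstar n g hg e he
    rw [mul_assoc, ← hb]
    exact hEK0 n f hf b
  have hEsub : ∀ n, ∀ e ∈ E n, ∀ P : Submodule ℂ (H →L[ℂ] H), IsClosed (P : Set (H →L[ℂ] H)) →
      (∀ k ∈ K n, ∀ f ∈ E n, k * f ∈ P) → e ∈ P := by
    intro n e he P hP h
    obtain ⟨g, hg⟩ := hstar n e he e he
    refine mem_of_approx hP 1 fun ε hε => ?_
    obtain ⟨u, hu⟩ := cstar_approx π e g hg.symm ε hε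
    exact ⟨_, h _ (hKgen n e he e he) _ (hEK0 n e he u), by simpa using hu⟩
  -- E_{n+m} = E_n E_m
  have hEadd : ∀ n m (P : Submodule ℂ (H →L[ℂ] H)), IsClosed (P : Set (H →L[ℂ] H)) →
      (∀ e ∈ E n, ∀ f ∈ E m, e * f ∈ P) → E (n + m) ≤ P := by
    intro n m P hP h
    refine csp_le hP ?_
    rintro _ ⟨a, ha, rfl⟩
    refine happ n m a ha P hP fun u hu => h _ (hgen n a fun x hx => ?_) _ (hgen m u hu)
    exact ha x fun h => hx ((Dn_add Δ φ n m x).1 h).1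
  have hKE' : ∀ n l, ∀ k ∈ K n, ∀ e ∈ E (n + l), k * e ∈ E (n + l) := by
    intro n l k hk e he
    have : E (n + l) ≤ (E (n + l)).comap
        ((ContinuousLinearMap.mul ℂ (H →L[ℂ] H) k : (H →L[ℂ] H) →ₗ[ℂ] (H →L[ℂ] H))) := by
      refine hEadd n l _ ((hEc _).preimage (ContinuousLinearMap.continuous _)) ?_
      intro e he f hf
      change k * (e * f) ∈ E (n + l)
      rw [← mul_assoc]
      exact hEE n l _ (hKE n k hk e he) f hf
    exact this he
  have hEsub' : ∀ n l (P : Submodule ℂ (H →L[ℂ] H)), IsClosed (P : Set (H →L[ℂ] H)) →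
      (∀ k ∈ K n, ∀ f ∈ E (n + l), k * f ∈ P) → E (n + l) ≤ P := by
    intro n l P hP h
    refine hEadd n l P hP fun e he f hf => ?_
    have hc : IsClosed ((P.comap ((ContinuousLinearMap.mul ℂ (H →L[ℂ] H)).flip f :
      (H →L[ℂ] H) →ₗ[ℂ] (H →L[ℂ] H)) : Submodule ℂ (H →L[ℂ] H)) : Set (H →L[ℂ] H)) :=
      hP.preimage (ContinuousLinearMap.continuous _)
    refine hEsub n e he _ hc fun k hk g hg => ?_
    change k * g * f ∈ P
    rw [mul_assoc]
    exact h k hk _ (hEE n l g hg f hf)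
  -- helper to conclude equalities
  have heq : ∀ (s : Set (H →L[ℂ] H)) (P : Submodule ℂ (H →L[ℂ] H)),
      IsClosed (P : Set (H →L[ℂ] H)) → (∀ x ∈ s, x ∈ P) → P ≤ csp s →
      closure (↑(Submodule.span ℂ s) : Set (H →L[ℂ] H)) = P := by
    intro s P hP h1 h2
    exact Set.Subset.antisymm (csp_le hP h1) h2
  have hKstar : ∀ n, ∀ x ∈ K n, star x ∈ K n := by
    intro n
    refine csp_star (hKc n) ?_
    rintro _ ⟨e, he, f, hf, rfl⟩
    rw [star_mul, star_star]
    exact hKgen n f hf e he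
  have hKK : ∀ n l, ∀ x ∈ K n, ∀ y ∈ K (n + l), x * y ∈ K (n + l) := by
    intro n l x hx y hy
    refine csp_mul_left (hKc _) x ?_ y hy
    rintro _ ⟨e, he, f, hf, rfl⟩
    rw [← mul_assoc]
    exact hKgen _ _ (hKE' n l x hx e he) f hf
  refine ⟨⟨heq _ _ (hEc n) ?_ ?_, hstar n⟩, heq _ _ (hEc (n + m)) ?_ ?_,
    ⟨hKK n 0, hKstar n, heq _ _ (hEc n) ?_ ?_⟩, fun hnm => ?_⟩
  · rintro _ ⟨e, he, _, ⟨b, rfl⟩, rfl⟩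
    exact hEK0 n e he b
  · refine csp_le (csp_closed _) ?_
    rintro _ ⟨a, ha, rfl⟩
    refine happ n 0 a ha _ (csp_closed _) fun u hu => sub_csp ⟨_, hgen n a ha, _, ⟨u, rfl⟩, ?_⟩
    rw [pow_zero, mul_one]
  · rintro _ ⟨e, he, f, hf, rfl⟩
    exact hEE n m e he f hf
  · exact hEadd n m _ (csp_closed _) fun e he f hf => sub_csp ⟨e, he, f, hf, rfl⟩
  · rintro _ ⟨k, hk, e, he, rfl⟩
    exact hKE n k hk e he
  · exact fun e he => hEsub n e he _ (csp_closed _) fun k hk f hf => sub_csp ⟨k, hk, f, hf, rfl⟩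
  · obtain ⟨l, rfl⟩ := Nat.exists_eq_add_of_le hnm
    refine heq _ _ (hKc (n + l)) ?_ ?_
    · rintro _ ⟨k, hk, k', hk', rfl⟩
      exact hKK n l k hk k' hk'
    · refine csp_le (csp_closed _) ?_
      rintro _ ⟨e, he, f, hf, rfl⟩
      have hc : IsClosed (((csp {S : H →L[ℂ] H | ∃ k ∈ Kspace Δ φ π T n,
          ∃ k' ∈ Kspace Δ φ π T (n + l), S = k * k'}).comap
          ((ContinuousLinearMap.mul ℂ (H →L[ℂ] H)).flip (star f) :
          (H →L[ℂ] H) →ₗ[ℂ] (H →L[ℂ] H)) : Submodule ℂ (H →L[ℂ] H)) : Set (H →L[ℂ] H)) :=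
        (csp_closed _).preimage (ContinuousLinearMap.continuous _)
      refine hEsub' n l _ hc (fun k hk g hg => ?_) he
      change k * g * star f ∈ csp _
      rw [mul_assoc]
      exact sub_csp ⟨k, hk, _, hKgen _ g hg f hf, rfl⟩
end
end

section
/- Let (π, T) be a representation of L on a Hilbert space H. For n ≥ 0 set E_n := the closed linear span of {π(a)Tⁿ : a ∈ C₀(Δ_n)} (E₀ = π(C₀(X))), K_n := the closed linear span of {e f* : e, f ∈ E_n}, and J := K₀ ∩ K₁. Then for every n ≥ 0, K_n ∩ K_{n+1} equals the closed linear span of {e j f* : e, f ∈ E_n, j ∈ J}. -/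
open scoped ZeroAtInfty

noncomputable section

variable {X : Type*} [TopologicalSpace X]

variable {H : Type*} [NormedAddCommGroup H] [InnerProductSpace ℂ H] [CompleteSpace H]

section Abstract

variable {B : Type*} [CStarAlgebra B]

/-- closure -/
local notation "cl" => Submodule.topologicalClosure

/-- the adjoint submodule -/
def stS (P : Submodule ℂ B) : Submodule ℂ B where
  carrier := {x | star x ∈ P}
  add_mem' := by
    intro a b ha hb
    simp only [Set.mem_ofPred_eq, star_add] at *
    exact P.add_mem ha hb
  zero_mem' := by simp
  smul_mem' := by
    intro c x hx
    simp only [Set.mem_ofPred_eq, star_smul] at *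
    exact P.smul_mem _ hx

lemma mem_stS {P : Submodule ℂ B} {x : B} : x ∈ stS P ↔ star x ∈ P := Iff.rfl

lemma stS_stS (P : Submodule ℂ B) : stS (stS P) = P := by
  ext x; simp [mem_stS]

lemma stS_mono {P Q : Submodule ℂ B} (h : P ≤ Q) : stS P ≤ stS Q := fun _ hx => h hx

lemma stS_mul_le (P Q : Submodule ℂ B) : stS (P * Q) ≤ stS Q * stS P := by
  have : P * Q ≤ stS (stS Q * stS P) := by
    rw [Submodule.mul_le]
    intro p hp q hq
    rw [mem_stS, star_mul]
    exact Submodule.mul_mem_mul (by simpa [mem_stS] using hq) (by simpa [mem_stS] using hp)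
  simpa [stS_stS] using stS_mono this

lemma stS_closed {P : Submodule ℂ B} (h : IsClosed (P : Set B)) :
    IsClosed (stS P : Set B) := h.preimage continuous_star

lemma stS_cl_le (P : Submodule ℂ B) : stS (cl P) ≤ cl (stS P) := by
  have : cl P ≤ stS (cl (stS P)) := by
    apply Submodule.topologicalClosure_minimal
    · have := stS_mono (Submodule.le_topologicalClosure (stS P))
      rwa [stS_stS] at this
    · exact stS_closed (Submodule.isClosed_topologicalClosure _)
  simpa [stS_stS] using stS_mono this

lemma le_cl (P : Submodule ℂ B) : P ≤ cl P := Submodule.le_topologicalClosure P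

lemma cl_le {P Q : Submodule ℂ B} (h : P ≤ cl Q) : cl P ≤ cl Q :=
  Submodule.topologicalClosure_minimal _ h (Submodule.isClosed_topologicalClosure _)

lemma mmL {P Q R : Submodule ℂ B} (h : P ≤ Q) : P * R ≤ Q * R := mul_le_mul' h le_rfl

lemma mmR {P Q R : Submodule ℂ B} (h : P ≤ Q) : R * P ≤ R * Q := mul_le_mul' le_rfl h

lemma cl_mul (P Q : Submodule ℂ B) : cl P * cl Q ≤ cl (P * Q) := by
  rw [Submodule.mul_le]
  intro p hp q hq
  have := map_mem_closure₂ (f := fun x y : B => x * y) continuous_mul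
    (s := (P : Set B)) (t := (Q : Set B)) (u := ((P * Q : Submodule ℂ B) : Set B)) hp hq
    (fun a ha b hb => Submodule.mul_mem_mul ha hb)
  exact this

lemma approx (K : Submodule ℂ B) (hc : IsClosed (K : Set B)) (hm : K * K ≤ K)
    (hs : stS K ≤ K) (P : Submodule ℂ B) (hP : P ≤ K) : P ≤ cl (K * P * K) := by
  intro k hk
  let S : NonUnitalStarSubalgebra ℂ B :=
    { K with
      mul_mem' := fun ha hb => hm (Submodule.mul_mem_mul ha hb)
      star_mem' := fun {a} ha => hs (by rw [mem_stS, star_star]; exact ha) }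
  have : IsClosed (S : Set B) := hc
  let : NonUnitalCStarAlgebra S := NonUnitalStarSubalgebra.nonUnitalCStarAlgebra S
  let := CStarAlgebra.spectralOrder S
  let := CStarAlgebra.spectralOrderedRing S
  have hu := (CStarAlgebra.increasingApproximateUnit S).toIsApproximateUnit
  let k' : S := ⟨k, hP hk⟩
  have h1 : k' ∈ closure (Set.range fun u : S => u * k') :=
    mem_closure_of_tendsto (hu.tendsto_mul_right k') (Filter.Eventually.of_forall fun u => ⟨u, rfl⟩)
  have h2 : k' ∈ closure (Set.range fun u : S => k' * u) :=
    mem_closure_of_tendsto (hu.tendsto_mul_left k') (Filter.Eventually.of_forall fun u => ⟨u, rfl⟩)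
  have h3 : k ∈ cl (K * P) :=
    map_mem_closure (f := ((↑) : S → B)) continuous_subtype_val h1
      (by rintro _ ⟨u, rfl⟩; exact Submodule.mul_mem_mul u.2 hk)
  have h4 : k ∈ cl ((cl (K * P)) * K) :=
    map_mem_closure (f := ((↑) : S → B)) continuous_subtype_val h2
      (by rintro _ ⟨u, rfl⟩; exact Submodule.mul_mem_mul h3 u.2)
  refine cl_le ?_ h4
  exact (mmR (le_cl K)).trans (cl_mul _ _)

theorem abstract_main (A E E1 F : Submodule ℂ B) (hAc : IsClosed (A : Set B))
    (hAs : stS A ≤ A) (hAA : A * A ≤ A) (hEE : stS E * E ≤ A) (hEA : E * A ≤ E)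
    (hAE1 : A * E1 ≤ E1) (hF : F = cl (E * E1)) :
    cl (E * stS E) ⊓ cl (F * stS F) =
      cl (E * (cl (A * stS A) ⊓ cl (E1 * stS E1)) * stS E) := by
  have hAst : stS A = A := le_antisymm hAs (by simpa [stS_stS] using stS_mono hAs)
  have clA : cl A = A := IsClosed.submodule_topologicalClosure_eq hAc
  have hK0 : cl (A * stS A) = A := by
    rw [hAst]
    apply le_antisymm
    · exact Submodule.topologicalClosure_minimal _ hAA hAc
    · refine (approx A hAc hAA hAs A le_rfl).trans (cl_le ?_)
      exact (mmL hAA).trans (le_cl _)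
  have hE1A : stS E1 * A ≤ stS E1 := by
    have := stS_mono hAE1
    intro x hx
    have h2 : stS E1 * A ≤ stS (A * E1) := by
      rw [Submodule.mul_le]
      intro p hp q hq
      rw [mem_stS, star_mul]
      exact Submodule.mul_mem_mul (by rw [← mem_stS, hAst]; exact hq) hp
    exact this (h2 hx)
  have hKs : ∀ G : Submodule ℂ B, stS (cl (G * stS G)) ≤ cl (G * stS G) := by
    intro G
    refine (stS_cl_le _).trans (Submodule.topologicalClosure_mono ?_)
    refine (stS_mul_le _ _).trans ?_
    rw [stS_stS]
  have hFF : cl (F * stS F) = cl (E * (E1 * stS E1) * stS E) := by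
    apply le_antisymm
    · apply cl_le
      have : stS F ≤ cl (stS E1 * stS E) := by
        rw [hF]
        exact (stS_cl_le _).trans (Submodule.topologicalClosure_mono (stS_mul_le _ _))
      calc F * stS F ≤ cl (E * E1) * cl (stS E1 * stS E) := mul_le_mul' hF.le this
        _ ≤ cl ((E * E1) * (stS E1 * stS E)) := cl_mul _ _
        _ = _ := by simp only [mul_assoc]
    · apply Submodule.topologicalClosure_mono
      have h1 : E * E1 ≤ F := by rw [hF]; exact le_cl _
      have h2 : stS E1 * stS E ≤ stS F := by
        rw [Submodule.mul_le]
        intro p hp q hq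
        rw [mem_stS, star_mul]
        exact h1 (Submodule.mul_mem_mul hq hp)
      calc E * (E1 * stS E1) * stS E = (E * E1) * (stS E1 * stS E) := by simp only [mul_assoc]
        _ ≤ _ := mul_le_mul' h1 h2
  rw [hK0, hFF]
  apply le_antisymm
  · set K := cl (E * stS E) with hK
    set P := K ⊓ cl (E * (E1 * stS E1) * stS E) with hP
    have hKm : K * K ≤ K := by
      refine (cl_mul _ _).trans (Submodule.topologicalClosure_mono ?_)
      calc E * stS E * (E * stS E) = E * (stS E * E) * stS E := by simp only [mul_assoc]
        _ ≤ E * A * stS E := mmL (mmR hEE)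
        _ ≤ _ := mmL hEA
    refine (approx K (Submodule.isClosed_topologicalClosure _) hKm (hKs E) P inf_le_left).trans ?_
    apply cl_le
    have hmid : stS E * P * E ≤ A ⊓ cl (E1 * stS E1) := by
      apply le_inf
      · calc stS E * P * E ≤ cl (stS E) * K * cl E :=
              mul_le_mul' (mul_le_mul' (le_cl _) inf_le_left) (le_cl _)
          _ ≤ cl (stS E * (E * stS E)) * cl E := mmL (cl_mul _ _)
          _ ≤ cl (stS E * (E * stS E) * E) := cl_mul _ _
          _ = cl ((stS E * E) * (stS E * E)) := by simp only [mul_assoc]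
          _ ≤ cl (A * A) := Submodule.topologicalClosure_mono (mul_le_mul' hEE hEE)
          _ ≤ cl A := Submodule.topologicalClosure_mono hAA
          _ = A := clA
      · calc stS E * P * E ≤ cl (stS E) * cl (E * (E1 * stS E1) * stS E) * cl E :=
              mul_le_mul' (mul_le_mul' (le_cl _) inf_le_right) (le_cl _)
          _ ≤ cl (stS E * (E * (E1 * stS E1) * stS E)) * cl E :=
              mmL (cl_mul _ _)
          _ ≤ cl (stS E * (E * (E1 * stS E1) * stS E) * E) := cl_mul _ _
          _ = cl ((stS E * E) * E1 * (stS E1 * (stS E * E))) := by simp only [mul_assoc]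
          _ ≤ cl ((A * E1) * (stS E1 * A)) := Submodule.topologicalClosure_mono
              (mul_le_mul' (mmL hEE)
                (mmR hEE))
          _ ≤ cl (E1 * stS E1) := Submodule.topologicalClosure_mono
              (mul_le_mul' hAE1 hE1A)
    calc K * P * K ≤ cl (E * stS E) * cl P * cl (E * stS E) :=
            mmL (mmR (le_cl _))
      _ ≤ cl (E * stS E * P) * cl (E * stS E) := mmL (cl_mul _ _)
      _ ≤ cl (E * stS E * P * (E * stS E)) := cl_mul _ _
      _ = cl (E * (stS E * P * E) * stS E) := by simp only [mul_assoc]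
      _ ≤ _ := Submodule.topologicalClosure_mono
          (mmL (mmR hmid))
  · apply le_inf
    · apply Submodule.topologicalClosure_mono
      calc E * (A ⊓ cl (E1 * stS E1)) * stS E ≤ E * A * stS E :=
            mmL (mmR inf_le_left)
        _ ≤ _ := mmL hEA
    · apply cl_le
      calc E * (A ⊓ cl (E1 * stS E1)) * stS E ≤ cl E * cl (E1 * stS E1) * cl (stS E) :=
            mul_le_mul' (mul_le_mul' (le_cl _) inf_le_right) (le_cl _)
        _ ≤ cl (E * (E1 * stS E1)) * cl (stS E) := mmL (cl_mul _ _)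
        _ ≤ _ := cl_mul _ _

end Abstract

section Concrete

/-- the transfer operator on arbitrary functions -/
def Lf (Δ : Set X) (φ : X → X) (ρ : X → ℝ) (a : X → ℂ) : X → ℂ :=
  fun y => ∑' x : Fiber Δ φ y, (ρ x.1 : ℂ) * a x.1

lemma Lf_mul (Δ : Set X) (φ : X → X) (ρ : X → ℝ) (a g : X → ℂ) :
    Lf Δ φ ρ (fun x => a x * g (φ x)) = fun y => Lf Δ φ ρ a y * g y := by
  funext y
  unfold Lf
  rw [← tsum_mul_right]
  congr 1
  funext x
  simp only [x.2.2, mul_assoc]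

lemma Lf_iter_mul (Δ : Set X) (φ : X → X) (ρ : X → ℝ) (n : ℕ) : ∀ (a g : X → ℂ),
    (Lf Δ φ ρ)^[n] (fun x => a x * g (φ^[n] x)) = fun y => (Lf Δ φ ρ)^[n] a y * g y := by
  induction n with
  | zero => intro a g; rfl
  | succ n ih =>
    intro a g
    rw [Function.iterate_succ_apply, Function.iterate_succ_apply, ← ih]
    congr 1
    exact Lf_mul Δ φ ρ a (fun x => g (φ^[n] x))

lemma Dn_succ_s13 (Δ : Set X) (φ : X → X) (n : ℕ) : Dn Δ φ (n + 1) = Δ ∩ φ ⁻¹' Dn Δ φ n := by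
  ext x
  constructor
  · intro h
    refine ⟨h 0 (Nat.succ_pos n), fun k hk => ?_⟩
    have := h (k + 1) (by omega)
    rwa [Function.iterate_succ_apply] at this
  · rintro ⟨h0, h⟩ k hk
    cases k with
    | zero => exact h0
    | succ k =>
      rw [Function.iterate_succ_apply]
      exact h k (by omega)

lemma Dn_open {Δ : Set X} {φ : X → X} (hΔ : IsOpen Δ) (hφ : ContinuousOn φ Δ) (n : ℕ) :
    IsOpen (Dn Δ φ n) := by
  induction n with
  | zero => 
    have : Dn Δ φ 0 = Set.univ := by ext x; simp [Dn]
    rw [this]; exact isOpen_univ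
  | succ n ih => rw [Dn_succ_s13]; exact hφ.isOpen_inter_preimage hΔ ih

lemma iter_contOn {Δ : Set X} {φ : X → X} (hφ : ContinuousOn φ Δ) (n : ℕ) :
    ContinuousOn (φ^[n]) (Dn Δ φ n) := by
  induction n with
  | zero => exact continuousOn_id
  | succ n ih =>
    rw [Dn_succ_s13, Function.iterate_succ]
    exact ih.comp (hφ.mono Set.inter_subset_left) (fun x hx => hx.2)

lemma exists_mul {Δ : Set X} {φ : X → X} (hΔ : IsOpen Δ) (hφ : ContinuousOn φ Δ) (n : ℕ)
    (a b : C₀(X, ℂ)) (ha : ∀ x ∉ Dn Δ φ n, a x = 0) :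
    ∃ c : C₀(X, ℂ), ∀ x, c x = a x * b (φ^[n] x) := by
  have hb : ∀ x, ‖b x‖ ≤ ‖b‖ := fun x => b.toBCF.norm_coe_le_norm x
  have hle : ∀ x, ‖a x * b (φ^[n] x)‖ ≤ ‖a x‖ * ‖b‖ := by
    intro x
    rw [norm_mul]
    exact mul_le_mul_of_nonneg_left (hb _) (norm_nonneg _)
  have hc : Continuous (fun x => a x * b (φ^[n] x)) := by
    rw [continuous_iff_continuousAt]
    intro x
    by_cases hx : x ∈ Dn Δ φ n
    · have h1 : ContinuousAt (φ^[n]) x :=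
        (iter_contOn hφ n).continuousAt ((Dn_open hΔ hφ n).mem_nhds hx)
      exact a.continuous.continuousAt.mul (b.continuous.continuousAt.comp h1)
    · have h0 : a x = 0 := ha x hx
      unfold ContinuousAt
      simp only [h0, zero_mul]
      refine squeeze_zero_norm hle ?_
      have : Filter.Tendsto (fun y => ‖a y‖ * ‖b‖) (nhds x) (nhds (‖a x‖ * ‖b‖)) :=
        (Continuous.tendsto (by fun_prop) x)
      simpa [h0] using this
  refine ⟨⟨⟨_, hc⟩, ?_⟩, fun x => rfl⟩
  refine squeeze_zero_norm hle ?_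
  have : Filter.Tendsto (fun y => ‖a y‖ * ‖b‖) (Filter.cocompact X) (nhds (‖(0:ℂ)‖ * ‖b‖)) :=
    (a.zero_at_infty'.norm).mul_const _
  simpa using this

variable {Δ : Set X} {φ : X → X} {ρ : X → ℝ} {M : ℝ}
  {π : C₀(X, ℂ) →⋆ₙₐ[ℂ] (H →L[ℂ] H)} {T : H →L[ℂ] H}

lemma rep_pow (hpot : IsPotential Δ φ ρ M) (hrep : IsRep Δ φ ρ π T) (n : ℕ) :
    ∀ a : C₀(X, ℂ), (∀ x ∉ Dn Δ φ n, a x = 0) →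
      ∃ b : C₀(X, ℂ), (⇑b = (Lf Δ φ ρ)^[n] a) ∧ star (T ^ n) * π a * T ^ n = π b := by
  induction n with
  | zero => intro a _; exact ⟨a, rfl, by simp⟩
  | succ n ih =>
    intro a ha
    have haΔ : ∀ x ∉ Δ, a x = 0 := by
      intro x hx
      apply ha
      rw [Dn_succ_s13]
      exact fun h => hx h.1
    obtain ⟨c, hc⟩ := hpot.2.2.2 a haΔ
    have hcL : ⇑c = Lf Δ φ ρ a := funext hc
    have hcD : ∀ y ∉ Dn Δ φ n, c y = 0 := by
      intro y hy
      rw [hc]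
      have : ∀ x : Fiber Δ φ y, (ρ x.1 : ℂ) * a x.1 = 0 := by
        intro x
        rw [ha x.1, mul_zero]
        rw [Dn_succ_s13]
        intro h
        apply hy
        have := h.2
        rw [Set.mem_preimage, x.2.2] at this
        exact this
      simp [this]
    obtain ⟨b, hb, hb'⟩ := ih c hcD
    refine ⟨b, ?_, ?_⟩
    · rw [hb, Function.iterate_succ_apply, hcL]
    · rw [← hb', hrep.2 a c haΔ hc, pow_succ' T n, star_mul]
      simp only [mul_assoc]

lemma covar (hpot : IsPotential Δ φ ρ M) (hrep : IsRep Δ φ ρ π T) (n : ℕ)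
    (a b c : C₀(X, ℂ)) (ha : ∀ x ∉ Dn Δ φ n, a x = 0)
    (hc : ∀ x, c x = a x * b (φ^[n] x)) :
    π a * T ^ n * π b = π c * T ^ n := by
  have hcD : ∀ x ∉ Dn Δ φ n, c x = 0 := fun x hx => by rw [hc, ha x hx, zero_mul]
  obtain ⟨p, hp, hp'⟩ := rep_pow hpot hrep n (star a * a) (fun x hx => by simp [ha x hx])
  obtain ⟨q, hq, hq'⟩ := rep_pow hpot hrep n (star a * c) (fun x hx => by simp [ha x hx])
  obtain ⟨r, hr, hr'⟩ := rep_pow hpot hrep n (star c * a) (fun x hx => by simp [ha x hx])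
  obtain ⟨s, hs, hs'⟩ := rep_pow hpot hrep n (star c * c) (fun x hx => by simp [hcD x hx])
  have eq : q = p * b := by
    ext y
    have h1 : ⇑(star a * c) = fun x => (star a * a) x * b (φ^[n] x) := by
      funext x; simp [hc]; ring
    rw [hq, h1, Lf_iter_mul, ← hp]; rfl
  have er : r = p * star b := by
    ext y
    have h1 : ⇑(star c * a) = fun x => (star a * a) x * (star b) (φ^[n] x) := by
      funext x; simp [hc]; ring
    rw [hr, h1, Lf_iter_mul, ← hp]; rfl
  have es : s = p * (star b * b) := by
    ext y
    have h1 : ⇑(star c * c) = fun x => (star a * a) x * (star b * b) (φ^[n] x) := by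
      funext x; simp [hc]; ring
    rw [hs, h1, Lf_iter_mul, ← hp]; rfl
  rw [← sub_eq_zero, ← CStarRing.star_mul_self_eq_zero_iff]
  rw [map_mul, map_star] at hp' hq' hr' hs'
  have h1 : star (π a * T ^ n * π b - π c * T ^ n) * (π a * T ^ n * π b - π c * T ^ n)
      = star (π b) * (star (T ^ n) * (star (π a) * π a) * T ^ n) * π b
        - star (π b) * (star (T ^ n) * (star (π a) * π c) * T ^ n)
        - (star (T ^ n) * (star (π c) * π a) * T ^ n) * π b
        + star (T ^ n) * (star (π c) * π c) * T ^ n := by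
    simp only [star_sub, star_mul, mul_assoc, sub_mul, mul_sub]
    abel
  rw [h1, hp', hq', hr', hs', eq, er, es, ← map_star]
  simp only [← map_mul, ← map_sub, ← map_add]
  have : star b * p * b - star b * (p * b) - p * star b * b + p * (star b * b) = 0 := by
    ext y
    simp
    ring
  rw [this, map_zero]

/-- generators -/
def gS (Δ : Set X) (φ : X → X) (π : C₀(X, ℂ) →⋆ₙₐ[ℂ] (H →L[ℂ] H))
    (T : H →L[ℂ] H) (n : ℕ) : Submodule ℂ (H →L[ℂ] H) :=
  Submodule.span ℂ {S : H →L[ℂ] H | ∃ a : C₀(X, ℂ),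
    (∀ x ∉ Dn Δ φ n, a x = 0) ∧ S = π a * T ^ n}

/-- closed module -/
def ES (Δ : Set X) (φ : X → X) (π : C₀(X, ℂ) →⋆ₙₐ[ℂ] (H →L[ℂ] H))
    (T : H →L[ℂ] H) (n : ℕ) : Submodule ℂ (H →L[ℂ] H) :=
  (gS Δ φ π T n).topologicalClosure

lemma gS_mem {n : ℕ} {a : C₀(X, ℂ)} (ha : ∀ x ∉ Dn Δ φ n, a x = 0) :
    π a * T ^ n ∈ gS Δ φ π T n := Submodule.subset_span ⟨a, ha, rfl⟩

lemma gS_mem0 (a : C₀(X, ℂ)) : π a ∈ gS Δ φ π T 0 := by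
  have := gS_mem (Δ := Δ) (φ := φ) (π := π) (T := T) (n := 0) (a := a)
    (fun x hx => absurd (fun k hk => absurd hk (Nat.not_lt_zero k)) hx)
  simpa using this

lemma ES_right (hΔ : IsOpen Δ) (hφ : ContinuousOn φ Δ)
    (hpot : IsPotential Δ φ ρ M) (hrep : IsRep Δ φ ρ π T) (n : ℕ) :
    ES Δ φ π T n * ES Δ φ π T 0 ≤ ES Δ φ π T n := by
  refine (cl_mul _ _).trans (Submodule.topologicalClosure_mono ?_)
  conv_lhs => unfold gS
  rw [Submodule.span_mul_span, Submodule.span_le]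
  rintro _ ⟨_, ⟨a, ha, rfl⟩, _, ⟨b, hb, rfl⟩, rfl⟩
  obtain ⟨c, hc⟩ := exists_mul hΔ hφ n a b ha
  have := covar hpot hrep n a b c ha hc
  simp only [pow_zero, mul_one, this]
  exact gS_mem (fun x hx => by rw [hc, ha x hx, zero_mul])

lemma ES_left (n : ℕ) : ES Δ φ π T 0 * ES Δ φ π T n ≤ ES Δ φ π T n := by
  refine (cl_mul _ _).trans (Submodule.topologicalClosure_mono ?_)
  conv_lhs => unfold gS
  rw [Submodule.span_mul_span, Submodule.span_le]
  rintro _ ⟨_, ⟨a, ha, rfl⟩, _, ⟨b, hb, rfl⟩, rfl⟩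
  simp only [pow_zero, mul_one, ← mul_assoc, ← map_mul]
  exact gS_mem (fun x hx => by simp [hb x hx])

lemma stS_gS_le (n : ℕ) : stS (gS Δ φ π T n) ≤ 
    Submodule.span ℂ {S : H →L[ℂ] H | ∃ a : C₀(X, ℂ),
      (∀ x ∉ Dn Δ φ n, a x = 0) ∧ S = star (T ^ n) * π a} := by
  have : gS Δ φ π T n ≤ stS (Submodule.span ℂ {S : H →L[ℂ] H | ∃ a : C₀(X, ℂ),
      (∀ x ∉ Dn Δ φ n, a x = 0) ∧ S = star (T ^ n) * π a}) := by
    unfold gS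
    rw [Submodule.span_le]
    rintro _ ⟨a, ha, rfl⟩
    refine Submodule.subset_span ⟨star a, fun x hx => by simp [ha x hx], ?_⟩
    rw [star_mul, map_star]
  simpa [stS_stS] using stS_mono this

lemma ES_star : stS (ES Δ φ π T 0) ≤ ES Δ φ π T 0 := by
  refine (stS_cl_le _).trans (Submodule.topologicalClosure_mono ?_)
  refine (stS_gS_le 0).trans ?_
  rw [Submodule.span_le]
  rintro _ ⟨a, ha, rfl⟩
  simpa using gS_mem0 a

lemma ES_inner (hpot : IsPotential Δ φ ρ M) (hrep : IsRep Δ φ ρ π T) (n : ℕ) :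
    stS (ES Δ φ π T n) * ES Δ φ π T n ≤ ES Δ φ π T 0 := by
  refine (mmL (stS_cl_le _)).trans ((cl_mul _ _).trans (Submodule.topologicalClosure_mono ?_))
  refine (mmL (stS_gS_le n)).trans ?_
  conv_lhs => unfold gS
  rw [Submodule.span_mul_span, Submodule.span_le]
  rintro _ ⟨_, ⟨a, ha, rfl⟩, _, ⟨b, hb, rfl⟩, rfl⟩
  obtain ⟨p, -, hp⟩ := rep_pow hpot hrep n (a * b) (fun x hx => by simp [ha x hx])
  have : star (T ^ n) * π a * (π b * T ^ n) = π p := by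
    rw [← hp, map_mul]; simp only [mul_assoc]
  simp only [this]
  exact gS_mem0 p

lemma Dn_succ_sub (n : ℕ) : Dn Δ φ (n + 1) ⊆ Dn Δ φ n :=
  fun _ hx k hk => hx k (by omega)

lemma approx_fn [LocallyCompactSpace X] [T2Space X] (hΔ : IsOpen Δ) (hφ : ContinuousOn φ Δ)
    (n : ℕ) (a : C₀(X, ℂ)) (ha : ∀ x ∉ Dn Δ φ (n + 1), a x = 0) (ε : ℝ) (hε : 0 < ε) :
    ∃ d c : C₀(X, ℂ), (∀ x ∉ Δ, d x = 0) ∧ (∀ x, c x = a x * d (φ^[n] x)) ∧ ‖c - a‖ ≤ ε := by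
  have hK : IsCompact {x | ε ≤ ‖a x‖} := by
    have h1 : ∀ᶠ x in Filter.cocompact X, ‖a x‖ < ε := by
      have := a.zero_at_infty'.norm
      rw [norm_zero] at this
      exact this.eventually (gt_mem_nhds hε)
    obtain ⟨K, hK, hK'⟩ := Filter.mem_cocompact.1 h1
    refine hK.of_isClosed_subset (isClosed_le continuous_const (by fun_prop)) ?_
    intro x hx
    by_contra hxK
    have h2 : ‖a x‖ < ε := hK' hxK
    exact absurd h2 (not_lt.2 hx)
  have hKD : {x | ε ≤ ‖a x‖} ⊆ Dn Δ φ (n + 1) := by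
    intro x hx
    by_contra h
    have hx' : ε ≤ ‖a x‖ := hx
    rw [ha x h, norm_zero] at hx'
    linarith
  have hK2 : IsCompact (φ^[n] '' {x | ε ≤ ‖a x‖}) :=
    hK.image_of_continuousOn ((iter_contOn hφ n).mono (hKD.trans (Dn_succ_sub n)))
  have hdis : Disjoint (φ^[n] '' {x | ε ≤ ‖a x‖}) Δᶜ := by
    rw [Set.disjoint_compl_right_iff_subset]
    rintro _ ⟨x, hx, rfl⟩
    exact hKD hx n (Nat.lt_succ_self n)
  obtain ⟨f, hf1, hf0, hfc, hf⟩ :=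
    exists_continuous_one_zero_of_isCompact hK2 hΔ.isClosed_compl hdis
  have hgc : HasCompactSupport (fun x => (f x : ℂ)) := hfc.comp_left (g := fun t : ℝ => (t : ℂ)) (by simp)
  let d : C₀(X, ℂ) := ⟨⟨fun x => (f x : ℂ), by fun_prop⟩, hgc.is_zero_at_infty⟩
  have hd : ∀ x, d x = (f x : ℂ) := fun x => rfl
  obtain ⟨c, hc⟩ := exists_mul hΔ hφ n a d (fun x hx => ha x (fun h => hx (Dn_succ_sub n h)))
  refine ⟨d, c, fun x hx => ?_, hc, ?_⟩
  · rw [hd, hf0 hx]; simp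
  · have : ‖(c - a).toBCF‖ ≤ ε := by
      rw [BoundedContinuousFunction.norm_le hε.le]
      intro x
      change ‖c x - a x‖ ≤ ε
      rw [hc, hd]
      by_cases hx : ε ≤ ‖a x‖
      · rw [hf1 ⟨x, hx, rfl⟩]; simp [hε.le]
      · push Not at hx
        have h2 : a x * (f (φ^[n] x) : ℂ) - a x = a x * (((f (φ^[n] x) - 1 : ℝ)) : ℂ) := by
          push_cast; ring
        rw [h2, norm_mul, Complex.norm_real, Real.norm_eq_abs]
        have h3 := hf (φ^[n] x)
        have h4 : |f (φ^[n] x) - 1| ≤ 1 := by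
          rw [abs_le]; constructor <;> linarith [h3.1, h3.2]
        nlinarith [norm_nonneg (a x), abs_nonneg (f (φ^[n] x) - 1)]
    exact this

lemma ES_succ [LocallyCompactSpace X] [T2Space X] (hΔ : IsOpen Δ) (hφ : ContinuousOn φ Δ)
    (hpot : IsPotential Δ φ ρ M) (hrep : IsRep Δ φ ρ π T) (n : ℕ) :
    ES Δ φ π T (n + 1) = (ES Δ φ π T n * ES Δ φ π T 1).topologicalClosure := by
  have hD1 : ∀ d : C₀(X, ℂ), (∀ x ∉ Δ, d x = 0) → ∀ x ∉ Dn Δ φ 1, d x = 0 := by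
    intro d hd x hx
    apply hd
    intro h
    apply hx
    intro k hk
    obtain rfl : k = 0 := by omega
    exact h
  apply le_antisymm
  · refine cl_le ?_
    unfold gS
    rw [Submodule.span_le]
    rintro _ ⟨a, ha, rfl⟩
    have haD : ∀ x ∉ Dn Δ φ n, a x = 0 := fun x hx => ha x (fun h => hx (Dn_succ_sub n h))
    change _ ∈ closure _
    rw [Metric.mem_closure_iff]
    intro ε hε
    obtain ⟨d, c, hd, hc, hca⟩ := approx_fn hΔ hφ n a ha (ε / (‖T ^ (n + 1)‖ + 1)) (by positivity)
    refine ⟨π c * T ^ (n + 1), ?_, ?_⟩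
    · have h1 := covar hpot hrep n a d c haD hc
      have h2 : π c * T ^ (n + 1) = (π a * T ^ n) * (π d * T ^ 1) := by
        rw [pow_one, ← mul_assoc, h1, pow_succ, mul_assoc]
      rw [h2]
      exact Submodule.mul_mem_mul (le_cl _ (gS_mem haD)) (le_cl _ (gS_mem (hD1 d hd)))
    · rw [dist_comm, dist_eq_norm, ← sub_mul, ← map_sub]
      have h1 : ‖π (c - a)‖ ≤ ‖c - a‖ := NonUnitalStarAlgHom.norm_apply_le π _
      calc ‖π (c - a) * T ^ (n + 1)‖ ≤ ‖π (c - a)‖ * ‖T ^ (n + 1)‖ := norm_mul_le _ _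
        _ ≤ ε / (‖T ^ (n + 1)‖ + 1) * ‖T ^ (n + 1)‖ :=
          mul_le_mul_of_nonneg_right (h1.trans hca) (norm_nonneg _)
        _ < ε / (‖T ^ (n + 1)‖ + 1) * (‖T ^ (n + 1)‖ + 1) := by
          apply mul_lt_mul_of_pos_left (by linarith)
          positivity
        _ = ε := by field_simp
  · refine cl_le ((cl_mul _ _).trans (Submodule.topologicalClosure_mono ?_))
    conv_lhs => unfold gS
    rw [Submodule.span_mul_span, Submodule.span_le]
    rintro _ ⟨_, ⟨a, ha, rfl⟩, _, ⟨b, hb, rfl⟩, rfl⟩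
    obtain ⟨c, hc⟩ := exists_mul hΔ hφ n a b ha
    have h1 := covar hpot hrep n a b c ha hc
    have h2 : (π a * T ^ n) * (π b * T ^ 1) = π c * T ^ (n + 1) := by
      rw [pow_one, ← mul_assoc, h1, pow_succ, mul_assoc]
    simp only [h2]
    refine gS_mem (fun x hx => ?_)
    rw [hc]
    by_cases hxa : x ∈ Dn Δ φ n
    · rw [hb, mul_zero]
      intro h
      apply hx
      intro k hk
      rcases Nat.lt_succ_iff_lt_or_eq.1 hk with hk | rfl
      · exact hxa k hk
      · exact h 0 Nat.zero_lt_one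
    · rw [ha x hxa, zero_mul]

lemma Kspace_eq (n : ℕ) : Kspace Δ φ π T n =
    ((ES Δ φ π T n * stS (ES Δ φ π T n)).topologicalClosure : Set (H →L[ℂ] H)) := by
  unfold Kspace
  rw [Submodule.topologicalClosure_coe, Submodule.mul_eq_span_mul_set]
  congr 3
  ext S
  constructor
  · rintro ⟨e, he, f, hf, rfl⟩
    exact ⟨e, he, star f, by rw [SetLike.mem_coe, mem_stS, star_star]; exact hf, rfl⟩
  · rintro ⟨e, he, f, hf, rfl⟩
    exact ⟨e, he, star f, hf, by simp⟩

end Concrete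

/-- For every `n`, `K_n ∩ K_{n+1}` equals the closed linear span of
`{e j f* : e, f ∈ E_n, j ∈ J}` where `J = K₀ ∩ K₁`. -/
theorem Kn_intersection
    {X : Type*} [TopologicalSpace X] [LocallyCompactSpace X] [T2Space X]
    (Δ : Set X) (φ : X → X) (ρ : X → ℝ) (M : ℝ)
    (hΔ : IsOpen Δ) (hφ : ContinuousOn φ Δ)
    (hcount : ∀ y : X, (Fiber Δ φ y).Countable)
    (hpot : IsPotential Δ φ ρ M)
    {H : Type*} [NormedAddCommGroup H] [InnerProductSpace ℂ H] [CompleteSpace H]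
    (π : C₀(X, ℂ) →⋆ₙₐ[ℂ] (H →L[ℂ] H)) (T : H →L[ℂ] H)
    (hrep : IsRep Δ φ ρ π T) (n : ℕ) :
    Kspace Δ φ π T n ∩ Kspace Δ φ π T (n + 1) =
      closure (↑(Submodule.span ℂ {S : H →L[ℂ] H | ∃ e ∈ Espace Δ φ π T n,
        ∃ j ∈ Kspace Δ φ π T 0 ∩ Kspace Δ φ π T 1,
        ∃ f ∈ Espace Δ φ π T n, S = e * j * star f}) : Set (H →L[ℂ] H)) := by
  have h := abstract_main (ES Δ φ π T 0) (ES Δ φ π T n) (ES Δ φ π T 1) (ES Δ φ π T (n + 1))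
    (Submodule.isClosed_topologicalClosure _) ES_star (ES_left 0) (ES_inner hpot hrep n)
    (ES_right hΔ hφ hpot hrep n) (ES_left 1) (ES_succ hΔ hφ hpot hrep n)
  rw [Kspace_eq n, Kspace_eq (n + 1), ← Submodule.coe_inf, h, Kspace_eq 0, Kspace_eq 1,
    ← Submodule.coe_inf, Submodule.topologicalClosure_coe]
  generalize ((ES Δ φ π T 0 * stS (ES Δ φ π T 0)).topologicalClosure ⊓
    (ES Δ φ π T 1 * stS (ES Δ φ π T 1)).topologicalClosure) = J
  congr 2
  apply le_antisymm
  · rw [Submodule.mul_le]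
    intro m hm f hf
    rw [← Submodule.span_eq (ES Δ φ π T n), ← Submodule.span_eq J, Submodule.span_mul_span] at hm
    induction hm using Submodule.span_induction with
    | mem x hx =>
      obtain ⟨e, he, j, hj, rfl⟩ := hx
      exact Submodule.subset_span ⟨e, he, j, hj, star f, hf, by simp⟩
    | zero => simp
    | add x y _ _ hx hy => rw [add_mul]; exact add_mem hx hy
    | smul c x _ hx => rw [smul_mul_assoc]; exact Submodule.smul_mem _ _ hx
  · rw [Submodule.span_le]
    rintro _ ⟨e, he, j, hj, f, hf, rfl⟩
    refine Submodule.mul_mem_mul (Submodule.mul_mem_mul he hj) ?_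
    rw [mem_stS, star_star]
    exact hf
end
end
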